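/- arXiv:1706.04569 — 4 statements merged into one kernel-verified Lean document; each statement's English description precedes it below -/
import Mathlib

section
/- Suppose d ∈ ℕ with d ≥ 1, n ∈ [2,3], and c ∈ [1.55, n). Then there exists μ_c < 0 such that the IVP with μ = μ_c has a solution Q ∈ C³([0,∞)) with Q(r) > 0 and Q_r(r) < 0 for all r > 0, and the limit L := lim_{r→∞} Q(r) exists and satisfies 0 < L < 1. -/
open Set Filter Topology intervalIntegral Real

noncomputable section

/-- The rescaled traveling-wave ODE for the magma equation at a point `r`. -/
def magmaODE (d n c : ℝ) (Q : ℝ → ℝ) (r : ℝ) : Prop :=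
  -deriv Q r + (1 / c) * deriv (fun s => Q s ^ n) r
    + deriv (fun s => Q s ^ n * deriv (deriv Q) s) r
    + (d - 1) * Q r ^ n * deriv (fun s => deriv Q s / s) r = 0

/-- Solution of the IVP on `[0, σ]`. -/
def isIVPSolutionOn (d n c μ : ℝ) (Q : ℝ → ℝ) (σ : ℝ) : Prop :=
  ContDiffOn ℝ 3 Q (Icc 0 σ) ∧ (∀ r ∈ Ioo (0:ℝ) σ, magmaODE d n c Q r) ∧
    Q 0 = 1 ∧ deriv Q 0 = 0 ∧ deriv (deriv Q) 0 = μ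

/-- Solution of the IVP on `[0, ∞)`. -/
def isIVPSolution (d n c μ : ℝ) (Q : ℝ → ℝ) : Prop :=
  ContDiffOn ℝ 3 Q (Ici 0) ∧ (∀ r : ℝ, 0 < r → magmaODE d n c Q r) ∧
    Q 0 = 1 ∧ deriv Q 0 = 0 ∧ deriv (deriv Q) 0 = μ

def F1 (d n c : ℝ) (Q μ : ℝ) : ℝ :=
  -(1 / (n - 1)) * (Q ^ (1 - n) - 1) - (n / c) * Real.log Q + μ * d

def F2 (d n c : ℝ) (Q μ : ℝ) : ℝ :=
  ∫ q in (1:ℝ)..Q, F1 d n c q μ * q ^ n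

def F3 (d n c : ℝ) (Q μ : ℝ) : ℝ :=
  F1 d n c Q μ - n * ∫ q in (1:ℝ)..Q, F2 d n c q μ * q ^ (-(n + 2))

def mu1 (d n c Q : ℝ) : ℝ := -(F1 d n c Q 0) / (F1 d n c Q 1 - F1 d n c Q 0)
def mu2 (d n c Q : ℝ) : ℝ := -(F2 d n c Q 0) / (F2 d n c Q 1 - F2 d n c Q 0)
def mu3 (d n c Q : ℝ) : ℝ := -(F3 d n c Q 0) / (F3 d n c Q 1 - F3 d n c Q 0)

def h3ex (d n Q : ℝ) : ℝ :=
  d * (1 - n * Real.log Q / (n + 1) - n / (n + 1) ^ 2 * (Q ^ (-(n + 1)) - 1))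

def setA (d n c Qs : ℝ) : Set ℝ :=
  {μ : ℝ | μ < 0 ∧ ∃ (Q : ℝ → ℝ) (σ rs : ℝ), 0 < rs ∧ rs < σ ∧
    isIVPSolutionOn d n c μ Q σ ∧ (∀ r ∈ Ioc (0:ℝ) σ, 0 < Q r ∧ deriv Q r < 0) ∧
    Q rs = Qs}

/-- An antiderivative of `q ^ (-n) - n * x / q`, equal to `a` at `q = 1`. -/
def firstIntegral (n x a q : ℝ) : ℝ :=
  (1 - q ^ (1 - n)) / (n - 1) - n * x * log q + a

/-- The antiderivative of `firstIntegral n x a q * q ^ n` vanishing at `q = 1`. -/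
def secondIntegral (n x a q : ℝ) : ℝ :=
  (q ^ (n + 1) - 1) / ((n - 1) * (n + 1)) - (q ^ 2 - 1) / (2 * (n - 1))
    - n * x * (q ^ (n + 1) * log q / (n + 1) - (q ^ (n + 1) - 1) / (n + 1) ^ 2)
    + a * (q ^ (n + 1) - 1) / (n + 1)

/-- `firstIntegral` minus `n` times the antiderivative of `secondIntegral n x a q * q ^ (-(n + 2))`
vanishing at `q = 1`. -/
def thirdIntegral (n x a q : ℝ) : ℝ :=
  firstIntegral n x a q
    - n * ((log q + (q ^ (-(n + 1)) - 1) / (n + 1)) / ((n - 1) * (n + 1))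
      - (-(q ^ (1 - n) - 1) / (n - 1) + (q ^ (-(n + 1)) - 1) / (n + 1)) / (2 * (n - 1))
      - n * x * (log q ^ 2 / (2 * (n + 1))
        - (log q + (q ^ (-(n + 1)) - 1) / (n + 1)) / (n + 1) ^ 2)
      + a * (log q + (q ^ (-(n + 1)) - 1) / (n + 1)) / (n + 1))

section ClosedForms

variable {n x a q : ℝ}

lemma hasDerivAt_firstIntegral (hn : 1 < n) (hq : 0 < q) :
    HasDerivAt (firstIntegral n x a) (q ^ (-n) - n * x / q) q := by
  have h1 := Real.hasDerivAt_rpow_const (x := q) (p := 1 - n) (Or.inl hq.ne')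
  have h2 := Real.hasDerivAt_log hq.ne'
  have h := ((((h1.const_sub 1).div_const (n - 1)).sub (h2.const_mul (n * x))).add_const a)
  refine h.congr_deriv ?_
  have e : (1 - n - 1 : ℝ) = -n := by ring
  rw [e]
  have : n - 1 ≠ 0 := by linarith
  field_simp
  ring

lemma hasDerivAt_secondIntegral (hn : 1 < n) (hq : 0 < q) :
    HasDerivAt (secondIntegral n x a) (firstIntegral n x a q * q ^ n) q := by
  have h1 := Real.hasDerivAt_rpow_const (x := q) (p := n + 1) (Or.inl hq.ne')
  have h2 := Real.hasDerivAt_log hq.ne'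
  have h3 := hasDerivAt_pow 2 q
  have h := ((((h1.sub_const 1).div_const ((n - 1) * (n + 1))).sub
    ((h3.sub_const 1).div_const (2 * (n - 1)))).sub
    ((((h1.mul h2).div_const (n + 1)).sub ((h1.sub_const 1).div_const ((n + 1) ^ 2))).const_mul
      (n * x))).add (((h1.sub_const 1).const_mul a).div_const (n + 1))
  refine h.congr_deriv ?_
  have e : (n + 1 - 1 : ℝ) = n := by ring
  have e2 : q ^ (n + 1) = q ^ n * q := by rw [rpow_add_one hq.ne']
  have e3 : q ^ (1 - n) = q / q ^ n := by rw [rpow_sub hq, rpow_one]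
  rw [e, e2, firstIntegral, e3]
  have h0 : n - 1 ≠ 0 := by linarith
  have h0' : n + 1 ≠ 0 := by linarith
  have := (rpow_pos_of_pos hq n).ne'
  field_simp
  ring

lemma hasDerivAt_thirdIntegral (hn : 1 < n) (hq : 0 < q) :
    HasDerivAt (thirdIntegral n x a)
      (q ^ (-n) - n * x / q - n * (secondIntegral n x a q * q ^ (-(n + 2)))) q := by
  have h0 := hasDerivAt_firstIntegral (x := x) (a := a) hn hq
  have h1 := Real.hasDerivAt_rpow_const (x := q) (p := -(n + 1)) (Or.inl hq.ne')
  have h1' := Real.hasDerivAt_rpow_const (x := q) (p := 1 - n) (Or.inl hq.ne')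
  have h2 := Real.hasDerivAt_log hq.ne'
  have h4 := h2.add ((h1.sub_const 1).div_const (n + 1))
  have h := h0.sub ((((h4.div_const ((n - 1) * (n + 1))).sub
    (((((h1'.sub_const 1).neg).div_const (n - 1)).add
      ((h1.sub_const 1).div_const (n + 1))).div_const (2 * (n - 1)))).sub
    ((((h2.pow 2).div_const (2 * (n + 1))).sub (h4.div_const ((n + 1) ^ 2))).const_mul
      (n * x))).add ((h4.const_mul a).div_const (n + 1)) |>.const_mul n)
  refine h.congr_deriv ?_
  have p := rpow_pos_of_pos hq n
  have e1 : q ^ (-(n + 1) - 1) = 1 / (q ^ n * q ^ 2) := by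
    rw [show -(n + 1) - 1 = -(n + (2:ℕ)) by push_cast; ring, rpow_neg hq.le, rpow_add hq,
      rpow_natCast, one_div]
  have e2 : q ^ (1 - n - 1) = 1 / q ^ n := by
    rw [show 1 - n - 1 = -n by ring, rpow_neg hq.le, one_div]
  have e3 : q ^ (-(n + 2)) = 1 / (q ^ n * q ^ 2) := by
    rw [show -(n + 2) = -(n + (2:ℕ)) by push_cast; ring, rpow_neg hq.le, rpow_add hq,
      rpow_natCast, one_div]
  have e4 : q ^ (n + 1) = q ^ n * q := by rw [rpow_add_one hq.ne']
  have e5 : q ^ (-n) = 1 / q ^ n := by rw [rpow_neg hq.le, one_div]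
  rw [e1, e2, e3, secondIntegral, e4, e5]
  have h0 : n - 1 ≠ 0 := by linarith
  have h0' : n + 1 ≠ 0 := by linarith
  field_simp
  ring

end ClosedForms

lemma exp_two_add_bounds {z : ℝ} (h0 : 0 ≤ z) (h1 : z ≤ 1) :
    7.389056 * (1 + z + z ^ 2 / 2 + z ^ 3 / 6) ≤ exp (2 + z) ∧
      exp (2 + z) ≤ 7.389057 * (1 + z + z ^ 2 / 2 + z ^ 3 / 6 + z ^ 4 * (5 / 96)) := by
  have e2 : exp (2 + z) = exp 1 ^ 2 * exp z := by
    rw [exp_add, ← exp_nat_mul]; norm_num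
  have l1 := exp_one_gt_d9
  have u1 := exp_one_lt_d9
  have lo : 7.389056 ≤ exp 1 ^ 2 := by nlinarith
  have up : exp 1 ^ 2 ≤ 7.389057 := by nlinarith
  have lz := Real.sum_le_exp_of_nonneg h0 4
  have uz := Real.exp_bound' h0 h1 (n := 4) (by norm_num)
  simp only [Finset.sum_range_succ, Finset.sum_range_zero, Nat.factorial] at lz uz
  norm_num at lz uz
  rw [e2]
  constructor
  · exact mul_le_mul lo (by linarith) (by positivity) (by positivity)
  · exact mul_le_mul up (by linarith) (exp_pos z).le (by norm_num)

lemma exists_exp_sub_self_eq {n : ℝ} (hn : n ∈ Icc (2 : ℝ) 3) :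
    ∃ y ∈ Icc (2.016 + 0.119 * (n - 2)) (2.0176 + 0.119 * (n - 2)),
      exp y - y = n + 3 + 1 / n := by
  obtain ⟨h2, h3⟩ := hn
  obtain ⟨t, rfl⟩ : ∃ t, n = 2 + t := ⟨n - 2, by ring⟩
  have t0 : 0 ≤ t := by linarith
  have t1 : t ≤ 1 := by linarith
  have hpos : (0 : ℝ) < 2 + t := by linarith
  have ht : 0 ≤ 1 - t := by linarith
  apply intermediate_value_Icc (f := fun y => exp y - y) (by linarith) (by fun_prop)
  constructor
  · have h := (exp_two_add_bounds (z := 0.016 + 0.119 * t) (by linarith) (by linarith)).2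
    have e : 2.016 + 0.119 * (2 + t - 2) = 2 + (0.016 + 0.119 * t) := by ring
    simp only [e]
    refine (sub_le_sub_right h _).trans ?_
    rw [← sub_nonneg]
    have : 0 ≤ ((2 + t + 3 + 1 / (2 + t)) -
      (7.389057 * (1 + (0.016 + 0.119 * t) + (0.016 + 0.119 * t) ^ 2 / 2
        + (0.016 + 0.119 * t) ^ 3 / 6 + (0.016 + 0.119 * t) ^ 4 * (5 / 96))
        - (2 + (0.016 + 0.119 * t)))) * (2 + t) := by
      rw [sub_mul, add_mul, one_div, inv_mul_cancel₀ hpos.ne']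
      have b := fun i j => mul_nonneg (pow_nonneg t0 i) (pow_nonneg ht j)
      linarith [b 0 5, b 1 4, b 2 3, b 3 2, b 4 1, b 5 0]
    exact nonneg_of_mul_nonneg_left this hpos
  · have h := (exp_two_add_bounds (z := 0.0176 + 0.119 * t) (by linarith) (by linarith)).1
    have e : 2.0176 + 0.119 * (2 + t - 2) = 2 + (0.0176 + 0.119 * t) := by ring
    simp only [e]
    refine le_trans ?_ (sub_le_sub_right h _)
    rw [← sub_nonneg]
    have : 0 ≤ ((7.389056 * (1 + (0.0176 + 0.119 * t) + (0.0176 + 0.119 * t) ^ 2 / 2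
        + (0.0176 + 0.119 * t) ^ 3 / 6)
        - (2 + (0.0176 + 0.119 * t))) - (2 + t + 3 + 1 / (2 + t))) * (2 + t) := by
      rw [sub_mul, add_mul (2 + t + 3), one_div, inv_mul_cancel₀ hpos.ne']
      have b := fun i j => mul_nonneg (pow_nonneg t0 i) (pow_nonneg ht j)
      linarith [b 0 4, b 1 3, b 2 2, b 3 1, b 4 0]
    exact nonneg_of_mul_nonneg_left this hpos

lemma thirdIntegral_exp_eq {n x a y : ℝ} (hn : 1 < n) (hy : exp y - y = n + 3 + 1 / n) :
    thirdIntegral n x a (exp (-y / (n + 1))) =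
      1 / 2 - (exp ((n - 1) * y / (n + 1)) - 1) * (3 * n - 2) / (2 * (n - 1) ^ 2)
        + n * y / (2 * (n - 1) * (n + 1))
        + n * x * (y / (n + 1) + n * y ^ 2 / (2 * (n + 1) ^ 3) - 1 / (n + 1)) := by
  have h0 : n - 1 ≠ 0 := by linarith
  have h0' : n + 1 ≠ 0 := by linarith
  have h0'' : n ≠ 0 := by linarith
  have e1 : exp (-y / (n + 1)) ^ (1 - n) = exp ((n - 1) * y / (n + 1)) := by
    rw [← exp_mul]; congr 1; ring
  have e2 : exp (-y / (n + 1)) ^ (-(n + 1)) = y + n + 3 + 1 / n := by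
    rw [← exp_mul, show -y / (n + 1) * -(n + 1) = y by field_simp]; linarith
  rw [thirdIntegral, firstIntegral, e1, e2, log_exp]
  generalize exp ((n - 1) * y / (n + 1)) = S
  field_simp
  ring

lemma thirdIntegral_exp_neg {n x a y : ℝ} (hn : n ∈ Icc (2 : ℝ) 3) (hx : 0 ≤ x)
    (hx' : x ≤ 20 / 31) (hy : exp y - y = n + 3 + 1 / n)
    (hy' : y ∈ Icc (2.016 + 0.119 * (n - 2)) (2.0176 + 0.119 * (n - 2))) :
    thirdIntegral n x a (exp (-y / (n + 1))) < 0 := by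
  obtain ⟨h2, h3⟩ := hn
  rw [thirdIntegral_exp_eq (by linarith) hy]
  obtain ⟨t, rfl⟩ : ∃ t, n = 2 + t := ⟨n - 2, by ring⟩
  have t0 : 0 ≤ t := by linarith
  have t1 : t ≤ 1 := by linarith
  have ht : 0 ≤ 1 - t := by linarith
  rw [show 2 + t - 2 = t by ring] at hy'
  obtain ⟨hl, hu⟩ := hy'
  rw [show 2 + t - 1 = 1 + t by ring, show 2 + t + 1 = 3 + t by ring]
  have y0 : 0 ≤ y := by linarith
  set Y := 2.016 + 0.119 * t with hY
  set Z := 2.0176 + 0.119 * t with hZ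
  have hS : 1 + (1 + t) * Y / (3 + t) + ((1 + t) * Y / (3 + t)) ^ 2 / 2
      + ((1 + t) * Y / (3 + t)) ^ 3 / 6 + ((1 + t) * Y / (3 + t)) ^ 4 / 24
      + ((1 + t) * Y / (3 + t)) ^ 5 / 120 ≤ exp ((1 + t) * y / (3 + t)) := by
    have hz : 0 ≤ (1 + t) * Y / (3 + t) := by positivity
    have h := Real.sum_le_exp_of_nonneg hz 6
    simp only [Finset.sum_range_succ, Finset.sum_range_zero, Nat.factorial] at h
    norm_num at h
    refine h.trans (exp_le_exp.2 ?_)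
    gcongr
  set S := exp ((1 + t) * y / (3 + t))
  have hA : y / (3 + t) + (2 + t) * y ^ 2 / (2 * (3 + t) ^ 3) - 1 / (3 + t) ≤
      Z / (3 + t) + (2 + t) * Z ^ 2 / (2 * (3 + t) ^ 3) - 1 / (3 + t) := by gcongr
  have hA0 : 0 ≤ Z / (3 + t) + (2 + t) * Z ^ 2 / (2 * (3 + t) ^ 3) - 1 / (3 + t) := by
    have : 0 ≤ (Z - 1) / (3 + t) := div_nonneg (by linarith) (by linarith)
    have h' : 0 ≤ (2 + t) * Z ^ 2 / (2 * (3 + t) ^ 3) := by positivity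
    rw [sub_div] at this
    linarith
  have hB : (2 + t) * x * (y / (3 + t) + (2 + t) * y ^ 2 / (2 * (3 + t) ^ 3) - 1 / (3 + t)) ≤
      (2 + t) * (20 / 31) *
        (Z / (3 + t) + (2 + t) * Z ^ 2 / (2 * (3 + t) ^ 3) - 1 / (3 + t)) := by
    refine (mul_le_mul_of_nonneg_left hA (by positivity)).trans ?_
    exact mul_le_mul_of_nonneg_right (by gcongr) hA0
  have hC : (2 + t) * y / (2 * (1 + t) * (3 + t)) ≤ (2 + t) * Z / (2 * (1 + t) * (3 + t)) := by
    gcongr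
  have hD : ((1 + t) * Y / (3 + t) + ((1 + t) * Y / (3 + t)) ^ 2 / 2
      + ((1 + t) * Y / (3 + t)) ^ 3 / 6 + ((1 + t) * Y / (3 + t)) ^ 4 / 24
      + ((1 + t) * Y / (3 + t)) ^ 5 / 120) * (3 * (2 + t) - 2) / (2 * (1 + t) ^ 2) ≤
      (S - 1) * (3 * (2 + t) - 2) / (2 * (1 + t) ^ 2) := by
    have : 0 ≤ 3 * (2 + t) - 2 := by linarith
    gcongr
    linarith
  have key : 1 / 2 - ((1 + t) * Y / (3 + t) + ((1 + t) * Y / (3 + t)) ^ 2 / 2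
      + ((1 + t) * Y / (3 + t)) ^ 3 / 6 + ((1 + t) * Y / (3 + t)) ^ 4 / 24
      + ((1 + t) * Y / (3 + t)) ^ 5 / 120) * (3 * (2 + t) - 2) / (2 * (1 + t) ^ 2)
      + (2 + t) * Z / (2 * (1 + t) * (3 + t)) + (2 + t) * (20 / 31) *
        (Z / (3 + t) + (2 + t) * Z ^ 2 / (2 * (3 + t) ^ 3) - 1 / (3 + t)) < 0 := by
    have p1 : 1 + t ≠ 0 := by positivity
    have p3 : 3 + t ≠ 0 := by positivity
    have hp : 0 < (1 + t) ^ 2 * (3 + t) ^ 5 := by positivity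
    refine neg_of_mul_neg_left (b := (1 + t) ^ 2 * (3 + t) ^ 5) ?_ hp.le
    have e : (1 / 2 - ((1 + t) * Y / (3 + t) + ((1 + t) * Y / (3 + t)) ^ 2 / 2
      + ((1 + t) * Y / (3 + t)) ^ 3 / 6 + ((1 + t) * Y / (3 + t)) ^ 4 / 24
      + ((1 + t) * Y / (3 + t)) ^ 5 / 120) * (3 * (2 + t) - 2) / (2 * (1 + t) ^ 2)
      + (2 + t) * Z / (2 * (1 + t) * (3 + t)) + (2 + t) * (20 / 31) *
        (Z / (3 + t) + (2 + t) * Z ^ 2 / (2 * (3 + t) ^ 3) - 1 / (3 + t))) *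
        ((1 + t) ^ 2 * (3 + t) ^ 5) =
        (1 + t) ^ 2 * (3 + t) ^ 5 / 2
        - ((1 + t) * Y * (3 + t) ^ 4 + (1 + t) ^ 2 * Y ^ 2 * (3 + t) ^ 3 / 2
          + (1 + t) ^ 3 * Y ^ 3 * (3 + t) ^ 2 / 6 + (1 + t) ^ 4 * Y ^ 4 * (3 + t) / 24
          + (1 + t) ^ 5 * Y ^ 5 / 120) * (3 * (2 + t) - 2) / 2
        + (2 + t) * Z * (1 + t) * (3 + t) ^ 4 / 2
        + (2 + t) * (20 / 31) * (1 + t) ^ 2 *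
          (Z * (3 + t) ^ 4 + (2 + t) * Z ^ 2 * (3 + t) ^ 2 / 2 - (3 + t) ^ 4) := by
      field_simp
    rw [e, hY, hZ]
    have b := fun i j => mul_nonneg (pow_nonneg t0 i) (pow_nonneg ht j)
    linarith [b 0 11, b 1 10, b 2 9, b 3 8, b 4 7, b 5 6, b 6 5, b 7 4, b 8 3, b 9 2, b 10 1,
      b 11 0]
  linarith

/-- The coefficient of `a` in `thirdIntegral n x a q`. -/
def thirdCoeff (n q : ℝ) : ℝ := 1 - n * (log q + (q ^ (-(n + 1)) - 1) / (n + 1)) / (n + 1)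

lemma thirdIntegral_eq_add (n x a q : ℝ) :
    thirdIntegral n x a q = thirdIntegral n x 0 q + a * thirdCoeff n q := by
  simp only [thirdIntegral, firstIntegral, thirdCoeff]
  ring

lemma secondIntegral_eq_add (n x a q : ℝ) :
    secondIntegral n x a q = secondIntegral n x 0 q + a * ((q ^ (n + 1) - 1) / (n + 1)) := by
  simp only [secondIntegral]
  ring

@[simp] lemma firstIntegral_one (n x a : ℝ) : firstIntegral n x a 1 = a := by
  simp [firstIntegral]

@[simp] lemma secondIntegral_one (n x a : ℝ) : secondIntegral n x a 1 = 0 := by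
  simp [secondIntegral]

@[simp] lemma thirdIntegral_one (n x a : ℝ) : thirdIntegral n x a 1 = a := by
  simp [thirdIntegral]

lemma hasDerivAt_thirdCoeff {n q : ℝ} (hn : 1 < n) (hq : 0 < q) :
    HasDerivAt (thirdCoeff n) (n / (n + 1) * (q⁻¹ * (q ^ (-(n + 1)) - 1))) q := by
  have h1 := Real.hasDerivAt_rpow_const (x := q) (p := -(n + 1)) (Or.inl hq.ne')
  have h2 := Real.hasDerivAt_log hq.ne'
  have h := (((h2.add ((h1.sub_const 1).div_const (n + 1))).const_mul n).div_const
    (n + 1)).const_sub 1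
  refine h.congr_deriv ?_
  have h0 : n + 1 ≠ 0 := by linarith
  rw [rpow_sub_one hq.ne']
  field_simp
  ring

lemma strictMonoOn_thirdCoeff {n : ℝ} (hn : 1 < n) : StrictMonoOn (thirdCoeff n) (Ioc 0 1) := by
  refine strictMonoOn_of_deriv_pos (convex_Ioc 0 1)
    (fun q hq => (hasDerivAt_thirdCoeff hn hq.1).continuousAt.continuousWithinAt) ?_
  intro q hq
  rw [interior_Ioc] at hq
  rw [(hasDerivAt_thirdCoeff hn hq.1).deriv]
  have : 1 < q ^ (-(n + 1)) := Real.one_lt_rpow_of_pos_of_lt_one_of_neg hq.1 hq.2 (by linarith)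
  have h0 := hq.1
  have h1 : 0 < q ^ (-(n + 1)) - 1 := by linarith
  positivity

lemma continuousOn_thirdIntegral {n x a : ℝ} (hn : 1 < n) :
    ContinuousOn (thirdIntegral n x a) (Ioi 0) := fun _ hq =>
  (hasDerivAt_thirdIntegral hn hq).continuousAt.continuousWithinAt

lemma continuousOn_secondIntegral {n x a : ℝ} (hn : 1 < n) :
    ContinuousOn (secondIntegral n x a) (Ioi 0) := fun _ hq =>
  (hasDerivAt_secondIntegral hn hq).continuousAt.continuousWithinAt

lemma continuousOn_firstIntegral {n x a : ℝ} (hn : 1 < n) :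
    ContinuousOn (firstIntegral n x a) (Ioi 0) := fun _ hq =>
  (hasDerivAt_firstIntegral hn hq).continuousAt.continuousWithinAt

/-- At the zero `b` of `thirdCoeff` the third integral does not depend on `a`. -/
lemma exists_critical_level {n x : ℝ} (hn : n ∈ Icc (2 : ℝ) 3) (hx : 0 ≤ x) (hx' : x ≤ 20 / 31) :
    ∃ b ∈ Ioo (0 : ℝ) 1, thirdCoeff n b = 0 ∧ ∀ a, thirdIntegral n x a b < 0 := by
  obtain ⟨y, hy, he⟩ := exists_exp_sub_self_eq hn
  have h2 := hn.1
  have y0 : 0 < y := by linarith [hy.1]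
  refine ⟨exp (-y / (n + 1)), ⟨exp_pos _, ?_⟩, ?_, fun a =>
    thirdIntegral_exp_neg hn hx hx' he hy⟩
  · rw [exp_lt_one_iff, neg_div, neg_lt_zero]
    positivity
  · have h0 : n + 1 ≠ 0 := by linarith
    have h0' : n ≠ 0 := by linarith
    have e2 : exp (-y / (n + 1)) ^ (-(n + 1)) = y + n + 3 + 1 / n := by
      rw [← exp_mul, show -y / (n + 1) * -(n + 1) = y by field_simp]; linarith
    rw [thirdCoeff, e2, log_exp]
    field_simp
    ring

lemma exists_thirdIntegral_neg {n x b : ℝ} (hn : 1 < n) (hb : b ∈ Ioo (0 : ℝ) 1)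
    (hk : thirdCoeff n b = 0) (hneg : thirdIntegral n x 0 b < 0) :
    ∃ a < 0, ∃ δ > 0, ∀ q ∈ Icc b 1, thirdIntegral n x a q ≤ -δ := by
  have hsub : Icc b 1 ⊆ Ioi 0 := fun q hq => hb.1.trans_le hq.1
  have hmono := strictMonoOn_thirdCoeff hn
  have hbm : b ∈ Ioc (0 : ℝ) 1 := ⟨hb.1, hb.2.le⟩
  obtain ⟨β, hbβ, hβ1, hβ⟩ : ∃ β, b < β ∧ β < 1 ∧ ∀ q ∈ Icc b β,
      thirdIntegral n x 0 q < thirdIntegral n x 0 b / 2 := by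
    have h := (continuousOn_thirdIntegral (x := x) (a := 0) hn).continuousAt (Ioi_mem_nhds hb.1)
    have h' := h.eventually_lt continuousAt_const
      (show thirdIntegral n x 0 b < thirdIntegral n x 0 b / 2 by linarith)
    obtain ⟨ε, hε, hball⟩ := Metric.eventually_nhds_iff.1 h'
    refine ⟨b + min (ε / 2) ((1 - b) / 2), ?_, ?_, ?_⟩
    · have : 0 < min (ε / 2) ((1 - b) / 2) := lt_min (by linarith) (by linarith [hb.2])
      linarith
    · linarith [min_le_right (ε / 2) ((1 - b) / 2), hb.2]
    · intro q hq
      apply hball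
      rw [Real.dist_eq, abs_of_nonneg (by linarith [hq.1])]
      linarith [hq.2, min_le_left (ε / 2) ((1 - b) / 2)]
  obtain ⟨C, hC⟩ := isCompact_Icc.exists_bound_of_continuousOn
    ((continuousOn_thirdIntegral (x := x) (a := 0) hn).mono hsub)
  have hβm : β ∈ Ioc (0 : ℝ) 1 := ⟨hb.1.trans hbβ, hβ1.le⟩
  have hkβ : 0 < thirdCoeff n β := hk ▸ hmono hbm hβm hbβ
  have hC0 : 0 ≤ C := (norm_nonneg _).trans (hC b ⟨le_rfl, hb.2.le⟩)
  refine ⟨-((C + 1) / thirdCoeff n β), by rw [neg_lt_zero]; positivity,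
    min 1 (-thirdIntegral n x 0 b / 2), lt_min one_pos (by linarith), ?_⟩
  intro q hq
  have hqm : q ∈ Ioc (0 : ℝ) 1 := ⟨hsub hq, hq.2⟩
  rw [thirdIntegral_eq_add]
  rcases le_total q β with h | h
  · have h1 := hβ q ⟨hq.1, h⟩
    have h2 : 0 ≤ thirdCoeff n q := hk ▸ hmono.monotoneOn hbm hqm hq.1
    have h3 : 0 ≤ (C + 1) / thirdCoeff n β * thirdCoeff n q := by positivity
    linarith [min_le_right 1 (-thirdIntegral n x 0 b / 2)]
  · have h1 := hC q hq
    rw [Real.norm_eq_abs] at h1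
    have h2 : thirdCoeff n β ≤ thirdCoeff n q := hmono.monotoneOn hβm hqm h
    have h3 : C + 1 ≤ (C + 1) / thirdCoeff n β * thirdCoeff n q := by
      rw [div_mul_eq_mul_div, le_div_iff₀ hkβ]
      gcongr
    linarith [min_le_left 1 (-thirdIntegral n x 0 b / 2), le_abs_self (thirdIntegral n x 0 q)]

lemma exists_secondIntegral_neg {n x b a₀ : ℝ} (hn : 1 < n) (hb : b ∈ Ioo (0 : ℝ) 1)
    (hx : 1 < n * x) (ha₀ : a₀ < 0) :
    ∃ q ∈ Ioo b 1, ∃ a ∈ Ioo a₀ 0, secondIntegral n x a q < 0 := by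
  have hev : ∀ᶠ q in 𝓝 (1 : ℝ), q ^ (-n) - n * x / q < 0 := by
    have hc : ContinuousAt (fun q : ℝ => q ^ (-n) - n * x / q) 1 :=
      (continuousAt_rpow_const _ _ (Or.inl one_ne_zero)).sub
        (continuousAt_const.div continuousAt_id one_ne_zero)
    exact hc.eventually_lt continuousAt_const (by simp; linarith)
  obtain ⟨ε, hε, hball⟩ := Metric.eventually_nhds_iff.1 hev
  set q₁ := 1 - min (ε / 2) ((1 - b) / 2) with hq₁
  have hm : 0 < min (ε / 2) ((1 - b) / 2) := lt_min (by linarith) (by linarith [hb.2])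
  have hq₁b : b < q₁ := by linarith [min_le_right (ε / 2) ((1 - b) / 2), hb.2]
  have hq₁1 : q₁ < 1 := by linarith
  have hsub : Icc q₁ 1 ⊆ Ioi 0 := fun q hq => (hb.1.trans hq₁b).trans_le hq.1
  have hanti : StrictAntiOn (firstIntegral n x 0) (Icc q₁ 1) := by
    refine strictAntiOn_of_deriv_neg (convex_Icc _ _)
      ((continuousOn_firstIntegral hn).mono hsub) fun q hq => ?_
    rw [interior_Icc] at hq
    rw [(hasDerivAt_firstIntegral hn (hsub ⟨hq.1.le, hq.2.le⟩)).deriv]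
    apply hball
    rw [Real.dist_eq, abs_of_nonpos (by linarith [hq.2])]
    linarith [hq.1, min_le_left (ε / 2) ((1 - b) / 2)]
  have hmono : StrictMonoOn (secondIntegral n x 0) (Icc q₁ 1) := by
    refine strictMonoOn_of_deriv_pos (convex_Icc _ _)
      ((continuousOn_secondIntegral hn).mono hsub) fun q hq => ?_
    rw [interior_Icc] at hq
    have hq0 := hsub ⟨hq.1.le, hq.2.le⟩
    rw [(hasDerivAt_secondIntegral hn hq0).deriv]
    have := hanti ⟨hq.1.le, hq.2.le⟩ ⟨hq₁1.le, le_rfl⟩ hq.2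
    rw [firstIntegral_one] at this
    exact mul_pos this (rpow_pos_of_pos hq0 n)
  have hlt : secondIntegral n x 0 q₁ < 0 := by
    simpa using hmono ⟨le_rfl, hq₁1.le⟩ ⟨hq₁1.le, le_rfl⟩ hq₁1
  have hcont : ContinuousAt (fun a => secondIntegral n x a q₁) 0 := by
    unfold secondIntegral
    fun_prop
  have h1 := (hcont.eventually_lt continuousAt_const hlt).filter_mono
    (nhdsWithin_le_nhds (s := Iio 0))
  obtain ⟨a, ha, ha'⟩ := (h1.and (Ioo_mem_nhdsLT ha₀)).exists
  exact ⟨q₁, ⟨hq₁b, hq₁1⟩, a, ha', ha⟩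

lemma exists_bound_integrals {n x b a₀ : ℝ} (hn : 1 < n) (hb : 0 < b) :
    ∃ C : ℝ, ∀ a ∈ Icc a₀ 0, ∀ q ∈ Icc b 1, thirdIntegral n x a q ≤ C ∧
      -C ≤ firstIntegral n x a q - n * (secondIntegral n x a q * q ^ (-(n + 1))) := by
  have hsub : Icc b 1 ⊆ Ioi 0 := fun q hq => hb.trans_le hq.1
  have hp : ∀ p : ℝ, ContinuousOn (fun q : ℝ => q ^ p) (Ioi 0) := fun p q hq =>
    (continuousAt_rpow_const q p (Or.inl (ne_of_gt hq))).continuousWithinAt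
  have hfst : ∀ p : ℝ × ℝ, p ∈ Icc a₀ 0 ×ˢ Icc b 1 → p.2 ∈ Ioi (0 : ℝ) := fun p h => hsub h.2
  have hc2 : ∀ f : ℝ → ℝ, ContinuousOn f (Ioi 0) →
      ContinuousOn (fun p : ℝ × ℝ => f p.2) (Icc a₀ 0 ×ˢ Icc b 1) := fun f hf =>
    hf.comp continuousOn_snd hfst
  have hl : ContinuousOn log (Ioi (0 : ℝ)) := fun q hq =>
    (continuousAt_log (ne_of_gt hq)).continuousWithinAt
  have hT : ContinuousOn (fun p : ℝ × ℝ => thirdIntegral n x p.1 p.2) (Icc a₀ 0 ×ˢ Icc b 1) := by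
    simp only [thirdIntegral_eq_add n x (Prod.fst _)]
    refine (hc2 _ (continuousOn_thirdIntegral hn)).add (continuousOn_fst.mul (hc2 _ ?_))
    exact fun q hq => (hasDerivAt_thirdCoeff hn hq).continuousAt.continuousWithinAt
  have hS : ContinuousOn (fun p : ℝ × ℝ => firstIntegral n x p.1 p.2
      - n * (secondIntegral n x p.1 p.2 * p.2 ^ (-(n + 1)))) (Icc a₀ 0 ×ˢ Icc b 1) := by
    have hF : ContinuousOn (fun p : ℝ × ℝ => firstIntegral n x p.1 p.2)
        (Icc a₀ 0 ×ˢ Icc b 1) := by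
      have h := (hc2 _ (continuousOn_firstIntegral (x := x) (a := 0) hn)).add
        (continuousOn_fst (s := Icc a₀ 0 ×ˢ Icc b 1))
      refine h.congr fun p _ => ?_
      simp [firstIntegral]
    refine hF.sub (continuousOn_const.mul (ContinuousOn.mul ?_ (hc2 _ (hp _))))
    simp only [secondIntegral_eq_add n x (Prod.fst _)]
    refine (hc2 _ (continuousOn_secondIntegral hn)).add
      (continuousOn_fst.mul (hc2 (fun q => (q ^ (n + 1) - 1) / (n + 1)) ?_))
    exact ((hp _).sub continuousOn_const).div_const _
  obtain ⟨C₁, h₁⟩ := (isCompact_Icc.prod isCompact_Icc).exists_bound_of_continuousOn hT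
  obtain ⟨C₂, h₂⟩ := (isCompact_Icc.prod isCompact_Icc).exists_bound_of_continuousOn hS
  refine ⟨max C₁ C₂, fun a ha q hq => ⟨?_, ?_⟩⟩
  · exact (le_abs_self _).trans ((h₁ (a, q) ⟨ha, hq⟩).trans (le_max_left _ _))
  · exact (neg_le_neg (le_max_right _ _)).trans (abs_le.1 (h₂ (a, q) ⟨ha, hq⟩)).1

/-- For a function `W` of the radius, `r * radialAverage k W r` solves
`p' + (k / r) * p = W` with `p 0 = 0`. -/
def radialAverage (k : ℕ) (W : ℝ → ℝ) (r : ℝ) : ℝ := ∫ t in (0 : ℝ)..1, t ^ k * W (t * r)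

/-- The profile `Q` with `Q 0 = 1` whose radial Laplacian in dimension `k + 1` is `W`. -/
def radialProfile (k : ℕ) (W : ℝ → ℝ) (r : ℝ) : ℝ := 1 + ∫ s in (0 : ℝ)..r, s * radialAverage k W s

lemma continuous_radialAverage {k : ℕ} {W : ℝ → ℝ} (hW : Continuous W) :
    Continuous (radialAverage k W) := by
  unfold radialAverage
  exact intervalIntegral.continuous_parametric_intervalIntegral_of_continuous'
    (f := fun r t => t ^ k * W (t * r)) (by fun_prop) 0 1

lemma hasDerivAt_radialProfile {k : ℕ} {W : ℝ → ℝ} (hW : Continuous W) (r : ℝ) :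
    HasDerivAt (radialProfile k W) (r * radialAverage k W r) r := by
  have h : Continuous fun s => s * radialAverage k W s :=
    continuous_id.mul (continuous_radialAverage hW)
  exact (intervalIntegral.integral_hasDerivAt_right (h.intervalIntegrable _ _)
    (h.stronglyMeasurableAtFilter _ _) h.continuousAt).const_add 1

lemma continuous_radialProfile {k : ℕ} {W : ℝ → ℝ} (hW : Continuous W) :
    Continuous (radialProfile k W) :=
  continuous_iff_continuousAt.2 fun r => (hasDerivAt_radialProfile hW r).continuousAt

lemma radialAverage_sub {k : ℕ} {V W : ℝ → ℝ} (hV : Continuous V) (hW : Continuous W) (r : ℝ) :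
    radialAverage k (fun s => V s - W s) r = radialAverage k V r - radialAverage k W r := by
  unfold radialAverage
  rw [← intervalIntegral.integral_sub]
  · simp only [mul_sub]
  · exact Continuous.intervalIntegrable (by fun_prop) _ _
  · exact Continuous.intervalIntegrable (by fun_prop) _ _

lemma radialAverage_const (k : ℕ) (c r : ℝ) : radialAverage k (fun _ => c) r = c / (k + 1) := by
  simp [radialAverage, integral_pow]
  ring

lemma radialAverage_zero (k : ℕ) (W : ℝ → ℝ) : radialAverage k W 0 = W 0 / (k + 1) := by
  rw [← radialAverage_const k (W 0) 0]
  simp [radialAverage]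

lemma radialProfile_zero (k : ℕ) (W : ℝ → ℝ) : radialProfile k W 0 = 1 := by
  simp [radialProfile]

lemma radialAverage_mono {k : ℕ} {V W : ℝ → ℝ} (hV : Continuous V) (hW : Continuous W) {r : ℝ}
    (h : ∀ t ∈ Icc (0 : ℝ) 1, V (t * r) ≤ W (t * r)) :
    radialAverage k V r ≤ radialAverage k W r := by
  refine intervalIntegral.integral_mono_on zero_le_one
    (Continuous.intervalIntegrable (by fun_prop) _ _)
    (Continuous.intervalIntegrable (by fun_prop) _ _) fun t ht => ?_
  exact mul_le_mul_of_nonneg_left (h t ht) (pow_nonneg ht.1 k)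

lemma abs_radialAverage_le {k : ℕ} {W : ℝ → ℝ} (hW : Continuous W) {r B : ℝ} (hB : 0 ≤ B)
    (h : ∀ t ∈ Icc (0 : ℝ) 1, |W (t * r)| ≤ B) : |radialAverage k W r| ≤ B := by
  have hB' : B / (k + 1) ≤ B := div_le_self hB (by linarith [(Nat.cast_nonneg k : (0 : ℝ) ≤ k)])
  have h1 := radialAverage_mono (k := k) hW (continuous_const (y := B)) (r := r)
    fun t ht => (abs_le.1 (h t ht)).2
  have h2 := radialAverage_mono (k := k) (continuous_const (y := -B)) hW (r := r)
    fun t ht => (abs_le.1 (h t ht)).1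
  rw [radialAverage_const] at h1 h2
  rw [neg_div] at h2
  exact abs_le.2 ⟨by linarith, by linarith⟩

lemma abs_integral_id_mul_le_of_nonneg {f : ℝ → ℝ} {K M r : ℝ} (hK : 0 < K)
    (hM : 0 ≤ M) (h : ∀ s, |f s| ≤ M * exp (K * s ^ 2)) (hr : 0 ≤ r) :
    |∫ s in (0 : ℝ)..r, s * f s| ≤ M / (2 * K) * exp (K * r ^ 2) := by
  have hd : ∀ s : ℝ, HasDerivAt (fun s => M / (2 * K) * exp (K * s ^ 2))
      (s * (M * exp (K * s ^ 2))) s := fun s => by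
    have := (((hasDerivAt_pow 2 s).const_mul K).exp).const_mul (M / (2 * K))
    refine this.congr_deriv ?_
    field_simp
    simp
  have hc : Continuous fun s : ℝ => s * (M * exp (K * s ^ 2)) := by fun_prop
  have hle := intervalIntegral.norm_integral_le_of_norm_le (f := fun s => s * f s) hr
    (MeasureTheory.ae_of_all _ fun s hs => by
      rw [norm_mul, norm_eq_abs, norm_eq_abs, abs_of_pos hs.1]
      exact mul_le_mul_of_nonneg_left (h s) hs.1.le)
    (hc.intervalIntegrable (μ := MeasureTheory.volume) 0 r)
  rw [intervalIntegral.integral_eq_sub_of_hasDerivAt (fun s _ => hd s)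
    (hc.intervalIntegrable _ _)] at hle
  rw [norm_eq_abs] at hle
  have : 0 ≤ M / (2 * K) * exp (K * 0 ^ 2) := by positivity
  linarith

lemma abs_integral_id_mul_le {f : ℝ → ℝ} {K M : ℝ} (hK : 0 < K)
    (hM : 0 ≤ M) (h : ∀ s, |f s| ≤ M * exp (K * s ^ 2)) (r : ℝ) :
    |∫ s in (0 : ℝ)..r, s * f s| ≤ M / (2 * K) * exp (K * r ^ 2) := by
  rcases le_total 0 r with hr | hr
  · exact abs_integral_id_mul_le_of_nonneg hK hM h hr
  · have := abs_integral_id_mul_le_of_nonneg (f := fun s => f (-s)) hK hM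
      (fun s => by simpa using h (-s)) (neg_nonneg.2 hr)
    rw [neg_sq] at this
    have e : ∫ s in (0 : ℝ)..-r, s * f (-s) = ∫ s in (0 : ℝ)..r, s * f s := by
      have e := intervalIntegral.integral_comp_neg (a := 0) (b := -r) (fun s => s * f s)
      rw [neg_neg, neg_zero] at e
      rw [intervalIntegral.integral_symm r 0, ← e, ← intervalIntegral.integral_neg]
      simp
    rwa [e] at this

lemma integral_id_mul_sub {f g : ℝ → ℝ} (hf : Continuous f) (hg : Continuous g) (r : ℝ) :
    (∫ s in (0 : ℝ)..r, s * f s) - ∫ s in (0 : ℝ)..r, s * g s =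
      ∫ s in (0 : ℝ)..r, s * (f s - g s) := by
  rw [← intervalIntegral.integral_sub]
  · simp only [mul_sub]
  · exact Continuous.intervalIntegrable (by fun_prop) _ _
  · exact Continuous.intervalIntegrable (by fun_prop) _ _

section Volterra

variable {k : ℕ} {h : ℝ → ℝ → ℝ → ℝ} {B C : ℝ}

/-- The nonlinearity `h` evaluated along the profile, the Laplacian `W` and its radial average. -/
def volterraIntegrand (k : ℕ) (h : ℝ → ℝ → ℝ → ℝ) (W : ℝ → ℝ) (s : ℝ) : ℝ :=
  h (radialProfile k W s) (W s) (radialAverage k W s)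

lemma continuous_volterraIntegrand (hc : Continuous fun p : ℝ × ℝ × ℝ => h p.1 p.2.1 p.2.2)
    {W : ℝ → ℝ} (hW : Continuous W) : Continuous (volterraIntegrand k h W) :=
  hc.comp ((continuous_radialProfile hW).prodMk (hW.prodMk (continuous_radialAverage hW)))

lemma continuous_integral_id_mul {f : ℝ → ℝ} (hf : Continuous f) :
    Continuous fun r => ∫ s in (0 : ℝ)..r, s * f s :=
  intervalIntegral.continuous_primitive
    (fun _ _ => (continuous_id.mul hf).intervalIntegrable _ _) 0

/-- Weighted Lipschitz estimate for the Volterra operator. -/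
lemma abs_integral_volterraIntegrand_sub_le
    (hc : Continuous fun p : ℝ × ℝ × ℝ => h p.1 p.2.1 p.2.2) (hC : 0 ≤ C)
    (hL : ∀ q w v q' w' v', |h q w v - h q' w' v'| ≤ C * (|q - q'| + |w - w'| + |v - v'|))
    {V W : ℝ → ℝ} (hV : Continuous V) (hW : Continuous W) {D : ℝ} (hD : 0 ≤ D)
    (hVW : ∀ s, |V s - W s| ≤ D * exp ((3 * C + 1) * s ^ 2)) (r : ℝ) :
    |(∫ s in (0 : ℝ)..r, s * volterraIntegrand k h V s)
      - ∫ s in (0 : ℝ)..r, s * volterraIntegrand k h W s| ≤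
      D / 2 * exp ((3 * C + 1) * r ^ 2) := by
  have hK : 0 < 3 * C + 1 := by linarith
  have havg : ∀ s, |radialAverage k V s - radialAverage k W s| ≤
      D * exp ((3 * C + 1) * s ^ 2) := fun s => by
    rw [← radialAverage_sub hV hW]
    refine abs_radialAverage_le (hV.sub hW) (by positivity) fun t ht => (hVW _).trans ?_
    have : (t * s) ^ 2 ≤ s ^ 2 := by
      rw [mul_pow]
      exact mul_le_of_le_one_left (sq_nonneg s) (pow_le_one₀ ht.1 ht.2)
    gcongr
  have hprof : ∀ s, |radialProfile k V s - radialProfile k W s| ≤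
      D * exp ((3 * C + 1) * s ^ 2) := fun s => by
    unfold radialProfile
    rw [add_sub_add_left_eq_sub, integral_id_mul_sub (continuous_radialAverage hV)
      (continuous_radialAverage hW)]
    refine (abs_integral_id_mul_le hK hD havg s).trans ?_
    gcongr
    exact div_le_self hD (by linarith)
  rw [integral_id_mul_sub (continuous_volterraIntegrand hc hV)
    (continuous_volterraIntegrand hc hW)]
  refine (abs_integral_id_mul_le (M := 3 * C * D) hK (by positivity) (fun s => ?_) r).trans ?_
  · refine (hL _ _ _ _ _ _).trans ?_
    have := mul_le_mul_of_nonneg_left (add_le_add (add_le_add (hprof s) (hVW s)) (havg s)) hC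
    linarith
  · refine mul_le_mul_of_nonneg_right ?_ (exp_pos _).le
    rw [div_le_div_iff₀ (by positivity) two_pos]
    nlinarith

open BoundedContinuousFunction in
lemma exists_volterra_solution (hc : Continuous fun p : ℝ × ℝ × ℝ => h p.1 p.2.1 p.2.2)
    (hC : 0 ≤ C)
    (hL : ∀ q w v q' w' v', |h q w v - h q' w' v'| ≤ C * (|q - q'| + |w - w'| + |v - v'|))
    (hB : ∀ q w v, |h q w v| ≤ B) (α : ℝ) :
    ∃ W : ℝ → ℝ, Continuous W ∧
      (∀ r, W r = α + ∫ s in (0 : ℝ)..r, s * volterraIntegrand k h W s) ∧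
      ∃ M, ∀ r, |W r| ≤ M * exp ((3 * C + 1) * r ^ 2) := by
  have hB0 : 0 ≤ B := (abs_nonneg _).trans (hB 0 0 0)
  have hK : 0 < 3 * C + 1 := by linarith
  let lift : (ℝ →ᵇ ℝ) → ℝ → ℝ := fun w r => exp ((3 * C + 1) * r ^ 2) * w r
  have hlift : ∀ w, Continuous (lift w) := fun w =>
    Continuous.mul (by fun_prop) w.continuous
  have hex : ∀ w : ℝ →ᵇ ℝ, ∃ v : ℝ →ᵇ ℝ, ∀ r, v r = exp (-((3 * C + 1) * r ^ 2)) *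
      (α + ∫ s in (0 : ℝ)..r, s * volterraIntegrand k h (lift w) s) := fun w => by
    refine ⟨BoundedContinuousFunction.ofNormedAddCommGroup
      (fun r => exp (-((3 * C + 1) * r ^ 2)) *
        (α + ∫ s in (0 : ℝ)..r, s * volterraIntegrand k h (lift w) s))
      (Continuous.mul (by fun_prop) (continuous_const.add
        (continuous_integral_id_mul (continuous_volterraIntegrand hc (hlift w)))))
      (|α| + B) (fun r => ?_), fun r => rfl⟩
    have h1 : |∫ s in (0 : ℝ)..r, s * volterraIntegrand k h (lift w) s| ≤
        B * exp ((3 * C + 1) * r ^ 2) := by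
      refine (abs_integral_id_mul_le hK hB0 (fun s => (hB _ _ _).trans ?_) r).trans ?_
      · exact le_mul_of_one_le_right hB0 (one_le_exp (by positivity))
      · gcongr
        exact div_le_self hB0 (by linarith)
    have h2 : |α| ≤ |α| * exp ((3 * C + 1) * r ^ 2) :=
      le_mul_of_one_le_right (abs_nonneg _) (one_le_exp (by positivity))
    rw [norm_eq_abs, abs_mul, abs_exp, exp_neg, inv_mul_le_iff₀ (exp_pos _)]
    refine (abs_add_le _ _).trans ?_
    linarith
  choose T hTr using hex
  have hT : ContractingWith (1 / 2) T := by
    refine ⟨by rw [← NNReal.coe_lt_coe]; norm_num, LipschitzWith.of_dist_le_mul fun v w => ?_⟩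
    rw [BoundedContinuousFunction.dist_le (by positivity)]
    intro r
    have h1 := abs_integral_volterraIntegrand_sub_le (k := k) hc hC hL (hlift v) (hlift w)
      (dist_nonneg (x := v) (y := w)) (fun s => by
        have := BoundedContinuousFunction.dist_coe_le_dist (f := v) (g := w) s
        rw [Real.dist_eq] at this
        rw [← mul_sub, abs_mul, abs_exp, mul_comm]
        gcongr) r
    rw [Real.dist_eq, hTr, hTr, ← mul_sub, add_sub_add_left_eq_sub, abs_mul, abs_exp, exp_neg,
      inv_mul_le_iff₀ (exp_pos _)]
    refine h1.trans (le_of_eq ?_)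
    push_cast
    ring
  have hfix : T hT.fixedPoint = hT.fixedPoint := hT.fixedPoint_isFixedPt
  generalize hT.fixedPoint = w at hfix
  refine ⟨lift w, hlift _, fun r => ?_, ‖w‖, fun r => ?_⟩
  · have e := hTr w r
    rw [hfix] at e
    simp only [lift] at e ⊢
    rw [e, ← mul_assoc, ← exp_add, add_neg_cancel, exp_zero, one_mul]
  · rw [abs_mul, abs_exp, mul_comm]
    gcongr
    exact w.norm_coe_le_norm r

/-- Solutions of the Volterra equation of Gaussian growth depend Lipschitz continuously on the
initial value. -/
lemma abs_volterra_solution_sub_le (hc : Continuous fun p : ℝ × ℝ × ℝ => h p.1 p.2.1 p.2.2)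
    (hC : 0 ≤ C)
    (hL : ∀ q w v q' w' v', |h q w v - h q' w' v'| ≤ C * (|q - q'| + |w - w'| + |v - v'|))
    {V W : ℝ → ℝ} (hV : Continuous V) (hW : Continuous W) {α β M N : ℝ}
    (hVM : ∀ r, |V r| ≤ M * exp ((3 * C + 1) * r ^ 2))
    (hWN : ∀ r, |W r| ≤ N * exp ((3 * C + 1) * r ^ 2))
    (eV : ∀ r, V r = α + ∫ s in (0 : ℝ)..r, s * volterraIntegrand k h V s)
    (eW : ∀ r, W r = β + ∫ s in (0 : ℝ)..r, s * volterraIntegrand k h W s) (r : ℝ) :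
    |V r - W r| ≤ 2 * |α - β| * exp ((3 * C + 1) * r ^ 2) := by
  let S : Set ℝ := range fun r => |V r - W r| * exp (-((3 * C + 1) * r ^ 2))
  have hS : BddAbove S := by
    refine ⟨M + N, ?_⟩
    rintro _ ⟨r, rfl⟩
    simp only
    rw [exp_neg, ← div_eq_mul_inv, div_le_iff₀ (exp_pos _)]
    refine (abs_sub _ _).trans ?_
    linarith [hVM r, hWN r]
  set D := sSup S
  have hle : ∀ s, |V s - W s| ≤ D * exp ((3 * C + 1) * s ^ 2) := fun s => by
    have := le_csSup hS ⟨s, rfl⟩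
    simp only at this
    rwa [exp_neg, ← div_eq_mul_inv, div_le_iff₀ (exp_pos _)] at this
  have hD0 : 0 ≤ D := by
    have := (abs_nonneg _).trans (hle 0)
    simpa using this
  have hD : D ≤ |α - β| + D / 2 := by
    refine csSup_le (range_nonempty _) ?_
    rintro _ ⟨r, rfl⟩
    simp only
    rw [exp_neg, ← div_eq_mul_inv, div_le_iff₀ (exp_pos _), eV r, eW r]
    have h1 := abs_integral_volterraIntegrand_sub_le (k := k) hc hC hL hV hW hD0 hle r
    have h2 : |α - β| ≤ |α - β| * exp ((3 * C + 1) * r ^ 2) :=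
      le_mul_of_one_le_right (abs_nonneg _) (one_le_exp (by positivity))
    rw [add_sub_add_comm]
    refine (abs_add_le _ _).trans ?_
    linarith
  refine (hle r).trans ?_
  gcongr
  linarith

end Volterra

lemma hasDerivAt_radialAverage {k : ℕ} {W W' : ℝ → ℝ} (hW : ∀ r, HasDerivAt W (W' r) r)
    (hW' : Continuous W') (r : ℝ) :
    HasDerivAt (radialAverage k W) (radialAverage (k + 1) W' r) r := by
  have hWc : Continuous W := continuous_iff_continuousAt.2 fun r => (hW r).continuousAt
  obtain ⟨B, hB⟩ := (isCompact_Icc (a := -(|r| + 1)) (b := |r| + 1)).exists_bound_of_continuousOn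
    hW'.continuousOn
  refine (intervalIntegral.hasDerivAt_integral_of_dominated_loc_of_deriv_le
    (F := fun r t => t ^ k * W (t * r)) (F' := fun r t => t ^ (k + 1) * W' (t * r))
    (bound := fun _ => B) (s := Metric.ball r 1) (μ := MeasureTheory.volume)
    (a := 0) (b := 1)
    (Metric.ball_mem_nhds r one_pos) ?_ ?_ ?_ ?_ ?_ ?_).2
  · exact Eventually.of_forall fun s => Continuous.aestronglyMeasurable (by fun_prop)
  · exact Continuous.intervalIntegrable (by fun_prop) _ _
  · exact Continuous.aestronglyMeasurable (by fun_prop)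
  · refine MeasureTheory.ae_of_all _ fun t ht s hs => ?_
    rw [uIoc_of_le zero_le_one] at ht
    rw [norm_mul, norm_eq_abs (t ^ (k + 1)), abs_of_nonneg (pow_nonneg ht.1.le _)]
    have hs' : |s| ≤ |r| + 1 := by
      rw [Metric.mem_ball, Real.dist_eq] at hs
      have := abs_sub_abs_le_abs_sub s r
      linarith
    have hts : |t * s| ≤ |r| + 1 := by
      rw [abs_mul, abs_of_pos ht.1]
      exact (mul_le_of_le_one_left (abs_nonneg s) ht.2).trans hs'
    have h1 := hB (t * s) (abs_le.1 hts)
    have h2 : t ^ (k + 1) ≤ 1 := pow_le_one₀ ht.1.le ht.2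
    exact (mul_le_of_le_one_left (norm_nonneg _) h2).trans h1
  · exact Continuous.intervalIntegrable continuous_const _ _
  · refine MeasureTheory.ae_of_all _ fun t _ s _ => ?_
    have h1 : HasDerivAt (fun s => t * s) t s := by simpa using (hasDerivAt_id s).const_mul t
    have h2 := ((hW (t * s)).comp s h1).const_mul (t ^ k)
    refine h2.congr_deriv ?_
    ring

lemma mul_radialAverage_deriv {k : ℕ} {W W' : ℝ → ℝ} (hW : ∀ r, HasDerivAt W (W' r) r)
    (hW' : Continuous W') (r : ℝ) :
    r * radialAverage (k + 1) W' r = W r - (k + 1) * radialAverage k W r := by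
  have hWc : Continuous W := continuous_iff_continuousAt.2 fun r => (hW r).continuousAt
  have hd : ∀ t ∈ uIcc (0 : ℝ) 1, HasDerivAt (fun t => t ^ (k + 1) * W (t * r))
      ((k + 1) * (t ^ k * W (t * r)) + r * (t ^ (k + 1) * W' (t * r))) t := fun t _ => by
    have h1 : HasDerivAt (fun t => t * r) r t := by simpa using (hasDerivAt_id t).mul_const r
    refine ((hasDerivAt_pow (k + 1) t).mul ((hW (t * r)).comp t h1)).congr_deriv ?_
    simp
    ring
  have e := intervalIntegral.integral_eq_sub_of_hasDerivAt hd
    (Continuous.intervalIntegrable (by fun_prop) _ _)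
  rw [intervalIntegral.integral_add (Continuous.intervalIntegrable (by fun_prop) _ _)
    (Continuous.intervalIntegrable (by fun_prop) _ _), intervalIntegral.integral_const_mul,
    intervalIntegral.integral_const_mul] at e
  simp only [one_pow, one_mul, zero_mul, ne_eq, Nat.succ_ne_zero, not_false_eq_true, zero_pow,
    sub_zero] at e
  unfold radialAverage
  linarith

/-- `W` solves the Volterra form of the initial value problem for the nonlinearity `h`. -/
def IsVolterraSolution (k : ℕ) (h : ℝ → ℝ → ℝ → ℝ) (α : ℝ) (W : ℝ → ℝ) : Prop :=
  Continuous W ∧ ∀ r, W r = α + ∫ s in (0 : ℝ)..r, s * volterraIntegrand k h W s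

namespace IsVolterraSolution

variable {k : ℕ} {h : ℝ → ℝ → ℝ → ℝ} {α : ℝ} {W : ℝ → ℝ}

lemma apply_zero (hs : IsVolterraSolution k h α W) : W 0 = α := by
  rw [hs.2 0, intervalIntegral.integral_same, add_zero]

lemma hasDerivAt (hs : IsVolterraSolution k h α W)
    (hc : Continuous fun p : ℝ × ℝ × ℝ => h p.1 p.2.1 p.2.2) (r : ℝ) :
    HasDerivAt W (r * h (radialProfile k W r) (W r) (radialAverage k W r)) r := by
  have hF : Continuous fun s => s * volterraIntegrand k h W s :=
    continuous_id.mul (continuous_volterraIntegrand hc hs.1)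
  have := (intervalIntegral.integral_hasDerivAt_right (hF.intervalIntegrable 0 r)
    (hF.stronglyMeasurableAtFilter _ _) hF.continuousAt).const_add α
  rwa [← funext hs.2] at this

lemma exists_hasDerivAt_radialAverage (hs : IsVolterraSolution k h α W)
    (hc : Continuous fun p : ℝ × ℝ × ℝ => h p.1 p.2.1 p.2.2) :
    ∃ v' : ℝ → ℝ, Continuous v' ∧ (∀ r, HasDerivAt (radialAverage k W) (v' r) r) ∧
      ∀ r, r * v' r = W r - (k + 1) * radialAverage k W r := by
  have hW' : Continuous fun r => r * h (radialProfile k W r) (W r) (radialAverage k W r) :=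
    continuous_id.mul (continuous_volterraIntegrand hc hs.1)
  exact ⟨_, continuous_radialAverage hW', hasDerivAt_radialAverage (hs.hasDerivAt hc) hW',
    mul_radialAverage_deriv (hs.hasDerivAt hc) hW'⟩

/-- The derivative of the slope `r * radialAverage k W r` of the profile. -/
lemma hasDerivAt_slope (hs : IsVolterraSolution k h α W)
    (hc : Continuous fun p : ℝ × ℝ × ℝ => h p.1 p.2.1 p.2.2) (r : ℝ) :
    HasDerivAt (fun r => r * radialAverage k W r) (W r - k * radialAverage k W r) r := by
  obtain ⟨v', -, hv, e⟩ := hs.exists_hasDerivAt_radialAverage hc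
  refine ((hasDerivAt_id r).mul (hv r)).congr_deriv ?_
  simp only [id, e]
  ring

lemma deriv_profile (hs : IsVolterraSolution k h α W) :
    deriv (radialProfile k W) = fun r => r * radialAverage k W r :=
  funext fun r => (hasDerivAt_radialProfile hs.1 r).deriv

lemma deriv_deriv_profile (hs : IsVolterraSolution k h α W)
    (hc : Continuous fun p : ℝ × ℝ × ℝ => h p.1 p.2.1 p.2.2) :
    deriv (deriv (radialProfile k W)) = fun r => W r - k * radialAverage k W r := by
  rw [hs.deriv_profile]
  exact funext fun r => (hs.hasDerivAt_slope hc r).deriv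

lemma contDiff_profile (hs : IsVolterraSolution k h α W)
    (hc : Continuous fun p : ℝ × ℝ × ℝ => h p.1 p.2.1 p.2.2) :
    ContDiff ℝ 3 (radialProfile k W) := by
  obtain ⟨v', hv'c, hv, -⟩ := hs.exists_hasDerivAt_radialAverage hc
  have c1 : ContDiff ℝ 1 (fun r => W r - k * radialAverage k W r) := by
    refine ContDiff.sub ?_ (contDiff_const.mul ?_)
    · rw [contDiff_one_iff_deriv]
      refine ⟨fun r => (hs.hasDerivAt hc r).differentiableAt, ?_⟩
      rw [funext fun r => (hs.hasDerivAt hc r).deriv]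
      exact continuous_id.mul (continuous_volterraIntegrand hc hs.1)
    · rw [contDiff_one_iff_deriv]
      refine ⟨fun r => (hv r).differentiableAt, ?_⟩
      rwa [funext fun r => (hv r).deriv]
  rw [show (3 : WithTop ℕ∞) = 2 + 1 by norm_num, contDiff_succ_iff_deriv]
  refine ⟨fun r => (hasDerivAt_radialProfile hs.1 r).differentiableAt, by simp, ?_⟩
  rw [show (2 : WithTop ℕ∞) = 1 + 1 by norm_num, contDiff_succ_iff_deriv]
  refine ⟨?_, by simp, ?_⟩
  · rw [hs.deriv_profile]
    exact fun r => (hs.hasDerivAt_slope hc r).differentiableAt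
  · rwa [hs.deriv_deriv_profile hc]

end IsVolterraSolution

/-- The right-hand side of the magma equation in dimension `k + 1`, divided by the radius. -/
def magmaRHS (k : ℕ) (n x q w v : ℝ) : ℝ := v * (q ^ (-n) - n * x / q - n / q * (w - k * v))

/-- `magmaRHS` with arguments clamped to `[b, 1]`, `[-M, M]` and `[-M, M]`. -/
def truncatedRHS (k : ℕ) (n x b M q w v : ℝ) : ℝ :=
  magmaRHS k n x (max b (min 1 q)) (max (-M) (min M w)) (max (-M) (min M v))

lemma truncatedRHS_eq {k : ℕ} {n x b M q w v : ℝ} (hq : q ∈ Icc b 1) (hw : |w| ≤ M)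
    (hv : |v| ≤ M) : truncatedRHS k n x b M q w v = magmaRHS k n x q w v := by
  rw [abs_le] at hw hv
  simp [truncatedRHS, hq.1, hq.2, hw.1, hw.2, hv.1, hv.2]

lemma clamp_mem_Icc {a b : ℝ} (hab : a ≤ b) (t : ℝ) : max a (min b t) ∈ Icc a b :=
  ⟨le_max_left _ _, max_le hab (min_le_left _ _)⟩

lemma abs_clamp_sub_le (a b s t : ℝ) : |max a (min b s) - max a (min b t)| ≤ |s - t| := by
  have := ((LipschitzWith.id (α := ℝ)).const_min b).const_max a
  simpa [Real.dist_eq] using this.dist_le_mul s t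

lemma contDiffOn_magmaRHS {k : ℕ} {n x b M : ℝ} (hb : 0 < b) :
    ContDiffOn ℝ 1 (fun p : ℝ × ℝ × ℝ => magmaRHS k n x p.1 p.2.1 p.2.2)
      (Icc b 1 ×ˢ Icc (-M) M ×ˢ Icc (-M) M) := by
  have hne : ∀ p ∈ Icc b 1 ×ˢ Icc (-M) M ×ˢ Icc (-M) M, p.1 ≠ 0 := fun p hp =>
    (hb.trans_le hp.1.1).ne'
  have h1 : ContDiffOn ℝ 1 (fun p : ℝ × ℝ × ℝ => p.1) (Icc b 1 ×ˢ Icc (-M) M ×ˢ Icc (-M) M) :=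
    contDiff_fst.contDiffOn
  have h2 : ContDiffOn ℝ 1 (fun p : ℝ × ℝ × ℝ => p.2.1) (Icc b 1 ×ˢ Icc (-M) M ×ˢ Icc (-M) M) :=
    (contDiff_fst.comp contDiff_snd).contDiffOn
  have h3 : ContDiffOn ℝ 1 (fun p : ℝ × ℝ × ℝ => p.2.2) (Icc b 1 ×ˢ Icc (-M) M ×ˢ Icc (-M) M) :=
    (contDiff_snd.comp contDiff_snd).contDiffOn
  unfold magmaRHS
  exact h3.mul (((h1.rpow_const_of_ne hne).sub (contDiffOn_const.div h1 hne)).sub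
    ((contDiffOn_const.div h1 hne).mul (h2.sub (contDiffOn_const.mul h3))))

lemma exists_lipschitz_truncatedRHS {k : ℕ} {n x b M : ℝ} (hb : 0 < b) (hb1 : b ≤ 1)
    (hM : 0 ≤ M) :
    (∃ C, 0 ≤ C ∧ ∀ q w v q' w' v', |truncatedRHS k n x b M q w v
      - truncatedRHS k n x b M q' w' v'| ≤ C * (|q - q'| + |w - w'| + |v - v'|)) ∧
    ∃ B, ∀ q w v, |truncatedRHS k n x b M q w v| ≤ B := by
  have hM' : -M ≤ M := by linarith
  have hK : IsCompact (Icc b 1 ×ˢ Icc (-M) M ×ˢ Icc (-M) M) :=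
    isCompact_Icc.prod (isCompact_Icc.prod isCompact_Icc)
  have hconv : Convex ℝ (Icc b 1 ×ˢ Icc (-M) M ×ˢ Icc (-M) M) :=
    (convex_Icc _ _).prod ((convex_Icc _ _).prod (convex_Icc _ _))
  have hd := contDiffOn_magmaRHS (k := k) (n := n) (x := x) (M := M) hb
  have hmem : ∀ q w v, (max b (min 1 q), max (-M) (min M w), max (-M) (min M v)) ∈
      Icc b 1 ×ˢ Icc (-M) M ×ˢ Icc (-M) M := fun q w v =>
    ⟨clamp_mem_Icc hb1 q, clamp_mem_Icc hM' w, clamp_mem_Icc hM' v⟩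
  constructor
  · obtain ⟨C, hC⟩ := hd.exists_lipschitzOnWith one_ne_zero hconv hK
    refine ⟨C, C.2, fun q w v q' w' v' => ?_⟩
    have h := hC.dist_le_mul _ (hmem q w v) _ (hmem q' w' v')
    rw [Real.dist_eq] at h
    refine h.trans (mul_le_mul_of_nonneg_left ?_ C.2)
    have h1 := abs_clamp_sub_le b 1 q q'
    have h2 := abs_clamp_sub_le (-M) M w w'
    have h3 := abs_clamp_sub_le (-M) M v v'
    rw [Prod.dist_eq, Prod.dist_eq, Real.dist_eq, Real.dist_eq, Real.dist_eq]
    have p1 := abs_nonneg (q - q')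
    have p2 := abs_nonneg (w - w')
    have p3 := abs_nonneg (v - v')
    refine max_le ?_ (max_le ?_ ?_) <;> simp only <;> linarith
  · obtain ⟨B, hB⟩ := hK.exists_bound_of_continuousOn hd.continuousOn
    exact ⟨B, fun q w v => hB _ (hmem q w v)⟩

lemma continuous_truncatedRHS {k : ℕ} {n x b M : ℝ} (hb : 0 < b) (hb1 : b ≤ 1) (hM : 0 ≤ M) :
    Continuous fun p : ℝ × ℝ × ℝ => truncatedRHS k n x b M p.1 p.2.1 p.2.2 :=
  (contDiffOn_magmaRHS (k := k) (n := n) (x := x) (M := M) hb).continuousOn.comp_continuous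
    (f := fun p : ℝ × ℝ × ℝ =>
      (max b (min 1 p.1), max (-M) (min M p.2.1), max (-M) (min M p.2.2)))
    (by fun_prop) fun p => ⟨clamp_mem_Icc hb1 _, clamp_mem_Icc (by linarith) _,
      clamp_mem_Icc (by linarith) _⟩

lemma le_of_hasDerivAt_nonneg {f f' : ℝ → ℝ} {R : ℝ} (hR : 0 ≤ R)
    (hf : ∀ r ∈ Icc 0 R, HasDerivAt f (f' r) r) (h : ∀ r ∈ Icc 0 R, 0 ≤ f' r) : f 0 ≤ f R :=
  monotoneOn_of_hasDerivWithinAt_nonneg (convex_Icc 0 R)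
    (fun r hr => (hf r hr).continuousAt.continuousWithinAt)
    (fun r hr => (hf r (interior_subset hr)).hasDerivWithinAt)
    (fun r hr => h r (interior_subset hr)) (left_mem_Icc.2 hR) (right_mem_Icc.2 hR) hR

/-- Monotone quantities of the magma equation along a decreasing profile. -/
lemma magma_integral_bounds {k : ℕ} {n x a R : ℝ} {Q v W : ℝ → ℝ} (hn : 1 < n) (hR : 0 ≤ R)
    (hQ : ∀ r, HasDerivAt Q (r * v r) r)
    (hv : ∀ r, HasDerivAt (fun r => r * v r) (W r - k * v r) r)
    (hW : ∀ r ∈ Icc 0 R, HasDerivAt W (r * magmaRHS k n x (Q r) (W r) (v r)) r)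
    (hQ0 : Q 0 = 1) (hW0 : W 0 = a) (hQpos : ∀ r ∈ Icc 0 R, 0 < Q r)
    (hvneg : ∀ r ∈ Icc 0 R, v r ≤ 0) :
    0 ≤ secondIntegral n x a (Q R) ∧ W R ≤ thirdIntegral n x a (Q R) ∧
      firstIntegral n x a (Q R) - n * (secondIntegral n x a (Q R) * Q R ^ (-(n + 1))) ≤ W R := by
  have hP : ∀ r, HasDerivAt (fun r => (r * v r) ^ 2 / 2) (r * v r * (W r - k * v r)) r := by
    intro r
    refine (((hv r).pow 2).div_const 2).congr_deriv ?_
    simp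
    ring
  have hPQ : ∀ r ∈ Icc 0 R, HasDerivAt (fun r => n * ((r * v r) ^ 2 / 2) / Q r)
      (n * (r * v r * (W r - k * v r)) / Q r - n * ((r * v r) ^ 2 / 2) * (r * v r) / Q r ^ 2) r :=
    fun r hr => by
      have h0 := (hQpos r hr).ne'
      refine (((hP r).const_mul n).div (hQ r) h0).congr_deriv ?_
      field_simp
  have hI' : ∀ r ∈ Icc 0 R, HasDerivAt (fun r => W r + n * ((r * v r) ^ 2 / 2) / Q r
      - firstIntegral n x a (Q r)) (n * ((r * v r) ^ 2 / 2) * (-(r * v r)) / Q r ^ 2) r :=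
    fun r hr => by
      refine (((hW r hr).add (hPQ r hr)).sub
        ((hasDerivAt_firstIntegral hn (hQpos r hr)).comp r (hQ r))).congr_deriv ?_
      unfold magmaRHS
      ring
  have hp : ∀ r ∈ Icc 0 R, 0 ≤ -(r * v r) := fun r hr => by
    rw [← mul_neg]
    exact mul_nonneg hr.1 (neg_nonneg.2 (hvneg r hr))
  have hI : ∀ r ∈ Icc 0 R, firstIntegral n x a (Q r) ≤ W r + n * ((r * v r) ^ 2 / 2) / Q r :=
    fun r hr => by
      have hsub : Icc 0 r ⊆ Icc 0 R := Icc_subset_Icc_right hr.2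
      have := le_of_hasDerivAt_nonneg hr.1 (fun s hs => hI' s (hsub hs)) fun s hs => by
        have h1 := hp s (hsub hs)
        have h2 := hQpos s (hsub hs)
        have h3 : 0 < n := by linarith
        positivity
      simp only [hQ0, hW0, firstIntegral_one] at this
      norm_num at this
      linarith
  have hD : ∀ r ∈ Icc 0 R, Q r ^ n * ((r * v r) ^ 2 / 2) ≤ secondIntegral n x a (Q r) :=
    fun r hr => by
      have hsub : Icc 0 r ⊆ Icc 0 R := Icc_subset_Icc_right hr.2
      have := le_of_hasDerivAt_nonneg (f := fun r => secondIntegral n x a (Q r)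
        - Q r ^ n * ((r * v r) ^ 2 / 2)) (f' := fun r => Q r ^ n * (-(r * v r) *
          (W r + n * ((r * v r) ^ 2 / 2) / Q r - firstIntegral n x a (Q r)) + k * (r * v r ^ 2)))
        hr.1 (fun s hs => by
          have h0 := hQpos s (hsub hs)
          refine (((hasDerivAt_secondIntegral hn h0).comp s (hQ s)).sub
            (((hQ s).rpow_const (p := n) (Or.inl h0.ne')).mul (hP s))).congr_deriv ?_
          rw [Real.rpow_sub_one h0.ne']
          ring) fun s hs => by
        have h1 := hp s (hsub hs)
        have h2 := hQpos s (hsub hs)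
        have h3 := sub_nonneg.2 (hI s (hsub hs))
        have h4 := hs.1
        positivity
      simp only [hQ0, secondIntegral_one] at this
      norm_num at this
      exact this
  have hD3 : W R + n * ((R * v R) ^ 2 / 2) / Q R ≤ thirdIntegral n x a (Q R) := by
    have := le_of_hasDerivAt_nonneg (f := fun r => thirdIntegral n x a (Q r)
      - (W r + n * ((r * v r) ^ 2 / 2) / Q r)) (f' := fun r => n * (-(r * v r) *
        (Q r ^ (-(n + 2)) * (secondIntegral n x a (Q r) - Q r ^ n * ((r * v r) ^ 2 / 2)))))
      hR (fun s hs => by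
        have h0 := hQpos s hs
        refine (((hasDerivAt_thirdIntegral hn h0).comp s (hQ s)).sub
          ((hW s hs).add (hPQ s hs))).congr_deriv ?_
        have e : Q s ^ (-(n + 2)) * Q s ^ n = (Q s ^ 2)⁻¹ := by
          rw [← Real.rpow_add h0, show -(n + 2) + n = -((2 : ℕ) : ℝ) by push_cast; ring,
            Real.rpow_neg h0.le, Real.rpow_natCast]
        unfold magmaRHS
        linear_combination (-n * (s * v s) * ((s * v s) ^ 2 / 2)) * e) fun s hs => by
      have h1 := hp s hs
      have h2 := hQpos s hs
      have h3 := sub_nonneg.2 (hD s hs)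
      have h4 : 0 < n := by linarith
      positivity
    simp only [hQ0, hW0, thirdIntegral_one] at this
    norm_num at this
    exact this
  have hmem := right_mem_Icc.2 hR
  have hQR := hQpos R hmem
  have h0 : 0 < n := by linarith
  have hnn : 0 ≤ n * ((R * v R) ^ 2 / 2) / Q R := by positivity
  refine ⟨le_trans (by positivity) (hD R hmem), by linarith, ?_⟩
  have h1 := mul_le_mul_of_nonneg_right (hD R hmem) (Real.rpow_nonneg hQR.le (-(n + 1)))
  have e : Q R ^ (-(n + 1)) * Q R ^ n = (Q R)⁻¹ := by
    rw [← Real.rpow_add hQR, show -(n + 1) + n = -1 by ring, Real.rpow_neg_one]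
  have h2 : Q R ^ n * ((R * v R) ^ 2 / 2) * Q R ^ (-(n + 1)) = ((R * v R) ^ 2 / 2) / Q R := by
    linear_combination ((R * v R) ^ 2 / 2) * e
  rw [h2] at h1
  have h3 := mul_le_mul_of_nonneg_left h1 h0.le
  have h4 := hI R hmem
  rw [← mul_div_assoc] at h3
  linarith

lemma antitoneOn_radialProfile {k : ℕ} {W : ℝ → ℝ} {R : ℝ} (hW : Continuous W)
    (hv : ∀ r ∈ Icc 0 R, radialAverage k W r ≤ 0) :
    AntitoneOn (radialProfile k W) (Icc 0 R) :=
  antitoneOn_of_hasDerivWithinAt_nonpos (convex_Icc 0 R)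
    (continuous_radialProfile hW).continuousOn
    (fun r _ => (hasDerivAt_radialProfile hW r).hasDerivWithinAt)
    fun r hr => mul_nonpos_of_nonneg_of_nonpos (interior_subset hr).1 (hv r (interior_subset hr))

lemma radialProfile_le_one {k : ℕ} {W : ℝ → ℝ} {R : ℝ} (hW : Continuous W) (hR : 0 ≤ R)
    (hv : ∀ r ∈ Icc 0 R, radialAverage k W r ≤ 0) : radialProfile k W R ≤ 1 := by
  have := antitoneOn_radialProfile hW hv (left_mem_Icc.2 hR) (right_mem_Icc.2 hR) hR
  rwa [radialProfile_zero] at this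

/-- Bounds on the closed-form integrals keep a decreasing solution inside the truncation region. -/
lemma abs_le_of_truncated {k : ℕ} {n x a b C M R : ℝ} {W : ℝ → ℝ} (hn : 1 < n)
    (hb : b ∈ Ioo (0 : ℝ) 1) (hM0 : 0 ≤ M) (hM : C < M)
    (hC : ∀ q ∈ Icc b 1, thirdIntegral n x a q ≤ C ∧
      -C ≤ firstIntegral n x a q - n * (secondIntegral n x a q * q ^ (-(n + 1))))
    (hs : IsVolterraSolution k (truncatedRHS k n x b M) a W)
    (hQ : ∀ r ∈ Icc 0 R, b ≤ radialProfile k W r)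
    (hv : ∀ r ∈ Icc 0 R, radialAverage k W r ≤ 0) :
    ∀ r ∈ Icc 0 R, |W r| ≤ M ∧
      HasDerivAt W (r * magmaRHS k n x (radialProfile k W r) (W r) (radialAverage k W r)) r := by
  have hc := continuous_truncatedRHS (k := k) (n := n) (x := x) hb.1 hb.2.le hM0
  have hderiv : ∀ s ∈ Icc 0 R, (∀ t ∈ Icc 0 s, |W t| ≤ M) →
      HasDerivAt W (s * magmaRHS k n x (radialProfile k W s) (W s) (radialAverage k W s)) s := by
    intro s hs' hW
    have := hs.hasDerivAt hc s
    rwa [truncatedRHS_eq ⟨hQ s hs', radialProfile_le_one hs.1 hs'.1 fun r hr =>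
      hv r ⟨hr.1, hr.2.trans hs'.2⟩⟩ (hW s ⟨hs'.1, le_rfl⟩)
      (abs_radialAverage_le hs.1 hM0 fun t ht => hW _ ⟨mul_nonneg ht.1 hs'.1,
        mul_le_of_le_one_left hs'.1 ht.2⟩)] at this
  suffices H : ∀ r ∈ Icc 0 R, |W r| ≤ M from fun r hr =>
    ⟨H r hr, hderiv r hr fun t ht => H t ⟨ht.1, ht.2.trans hr.2⟩⟩
  by_contra! hne
  obtain ⟨r, hr, hrM⟩ := hne
  obtain ⟨s, ⟨hs', hsM⟩, hmin⟩ := (isCompact_Icc.inter_right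
    (isClosed_le continuous_const hs.1.abs : IsClosed {r | M ≤ |W r|})).exists_isLeast
      (⟨r, hr, hrM.le⟩ : (Icc 0 R ∩ {r | M ≤ |W r|}).Nonempty)
  simp only [mem_ofPred_eq] at hsM
  have hbelow : ∀ t ∈ Ico 0 s, |W t| ≤ M := fun t ht => by
    by_contra! h
    exact (hmin ⟨⟨ht.1, ht.2.le.trans hs'.2⟩, h.le⟩).not_gt ht.2
  have hbelow' : ∀ t ∈ Icc 0 s, |W t| ≤ M := by
    rcases hs'.1.eq_or_lt with h0 | h0
    · have h1 := (hC 1 ⟨hb.2.le, le_rfl⟩)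
      simp only [firstIntegral_one, secondIntegral_one, thirdIntegral_one, zero_mul, mul_zero,
        sub_zero] at h1
      rintro t ht
      rw [← h0, Icc_self] at ht
      rw [ht, hs.apply_zero, abs_le]
      constructor <;> linarith
    · intro t ht
      rw [← closure_Ico h0.ne] at ht
      exact closure_minimal hbelow (isClosed_le hs.1.abs continuous_const) ht
  have hsub : Icc 0 s ⊆ Icc 0 R := Icc_subset_Icc_right hs'.2
  have key := magma_integral_bounds hn hs'.1 (hasDerivAt_radialProfile hs.1)
    (hs.hasDerivAt_slope hc)
    (fun t ht => hderiv t (hsub ht) fun u hu => hbelow' u ⟨hu.1, hu.2.trans ht.2⟩)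
    (radialProfile_zero k W) hs.apply_zero (fun t ht => hb.1.trans_le (hQ t (hsub ht)))
    (fun t ht => hv t (hsub ht))
  have h1 := hC _ ⟨hQ s hs', radialProfile_le_one hs.1 hs'.1 fun r hr => hv r (hsub hr)⟩
  rcases le_abs.1 hsM with h | h <;> linarith [key.2.1, key.2.2, h1.1, h1.2]

lemma integral_bounds_of_truncated {k : ℕ} {n x a b C M R : ℝ} {W : ℝ → ℝ} (hn : 1 < n)
    (hb : b ∈ Ioo (0 : ℝ) 1) (hM0 : 0 ≤ M) (hM : C < M)
    (hC : ∀ q ∈ Icc b 1, thirdIntegral n x a q ≤ C ∧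
      -C ≤ firstIntegral n x a q - n * (secondIntegral n x a q * q ^ (-(n + 1))))
    (hs : IsVolterraSolution k (truncatedRHS k n x b M) a W) (hR : 0 ≤ R)
    (hQ : ∀ r ∈ Icc 0 R, b ≤ radialProfile k W r)
    (hv : ∀ r ∈ Icc 0 R, radialAverage k W r ≤ 0) :
    0 ≤ secondIntegral n x a (radialProfile k W R) ∧
      W R ≤ thirdIntegral n x a (radialProfile k W R) := by
  have hc := continuous_truncatedRHS (k := k) (n := n) (x := x) hb.1 hb.2.le hM0
  have key := magma_integral_bounds hn hR (hasDerivAt_radialProfile hs.1) (hs.hasDerivAt_slope hc)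
    (fun t ht => (abs_le_of_truncated hn hb hM0 hM hC hs hQ hv t ht).2)
    (radialProfile_zero k W) hs.apply_zero (fun t ht => hb.1.trans_le (hQ t ht)) hv
  exact ⟨key.1, key.2.1⟩

/-- Uniformly on bounded intervals, radial averages and profiles depend continuously on the
function. -/
lemma abs_radialProfile_sub_le {k : ℕ} {V W : ℝ → ℝ} (hV : Continuous V) (hW : Continuous W)
    {R D : ℝ} (hD : 0 ≤ D) (h : ∀ r ∈ Icc 0 R, |V r - W r| ≤ D) :
    ∀ r ∈ Icc 0 R, |radialAverage k V r - radialAverage k W r| ≤ D ∧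
      |radialProfile k V r - radialProfile k W r| ≤ R ^ 2 * D := by
  have havg : ∀ r ∈ Icc 0 R, |radialAverage k V r - radialAverage k W r| ≤ D := fun r hr => by
    rw [← radialAverage_sub hV hW]
    exact abs_radialAverage_le (hV.sub hW) hD fun t ht => h _
      ⟨mul_nonneg ht.1 hr.1, (mul_le_of_le_one_left hr.1 ht.2).trans hr.2⟩
  refine fun r hr => ⟨havg r hr, ?_⟩
  unfold radialProfile
  rw [add_sub_add_left_eq_sub, integral_id_mul_sub (continuous_radialAverage hV)
    (continuous_radialAverage hW)]
  have hR : 0 ≤ R := hr.1.trans hr.2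
  have := intervalIntegral.norm_integral_le_of_norm_le_const (a := 0) (b := r) (C := R * D)
    (f := fun s => s * (radialAverage k V s - radialAverage k W s)) fun s hs' => by
      rw [uIoc_of_le hr.1] at hs'
      rw [norm_mul, norm_eq_abs, norm_eq_abs, abs_of_pos hs'.1]
      exact mul_le_mul (hs'.2.trans hr.2) (havg s ⟨hs'.1.le, hs'.2.trans hr.2⟩) (abs_nonneg _) hR
  rw [sub_zero, norm_eq_abs, abs_of_nonneg hr.1] at this
  refine this.trans ?_
  nlinarith [mul_nonneg hR hD, hr.2]

lemma exists_truncated_family {k : ℕ} {n x b M : ℝ} (hb : b ∈ Ioo (0 : ℝ) 1) (hM0 : 0 ≤ M) :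
    ∃ W : ℝ → ℝ → ℝ, (∀ a, IsVolterraSolution k (truncatedRHS k n x b M) a (W a)) ∧
      ∀ a R ε, 0 ≤ R → 0 < ε → ∀ᶠ a' in 𝓝 a, ∀ r ∈ Icc 0 R,
        |radialAverage k (W a') r - radialAverage k (W a) r| < ε ∧
        |radialProfile k (W a') r - radialProfile k (W a) r| < ε := by
  have hc := continuous_truncatedRHS (k := k) (n := n) (x := x) hb.1 hb.2.le hM0
  obtain ⟨⟨C, hC, hL⟩, B, hB⟩ :=
    exists_lipschitz_truncatedRHS (k := k) (n := n) (x := x) hb.1 hb.2.le hM0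
  choose W hW hWe M hWM using exists_volterra_solution (k := k) hc hC hL hB
  refine ⟨W, fun a => ⟨hW a, hWe a⟩, fun a R ε hR hε => ?_⟩
  have ht : Tendsto (fun a' => (R ^ 2 + 1) * (2 * |a' - a| * exp ((3 * C + 1) * R ^ 2))) (𝓝 a)
      (𝓝 0) := by
    have : Continuous fun a' => (R ^ 2 + 1) * (2 * |a' - a| * exp ((3 * C + 1) * R ^ 2)) := by
      fun_prop
    simpa using this.tendsto a
  filter_upwards [ht.eventually_lt_const hε] with a' ha' r hr
  set D := 2 * |a' - a| * exp ((3 * C + 1) * R ^ 2)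
  have hD : 0 ≤ D := by positivity
  obtain ⟨h1, h2⟩ := abs_radialProfile_sub_le (k := k) (hW a') (hW a) hD (fun s hs => by
    refine (abs_volterra_solution_sub_le hc hC hL (hW a') (hW a) (hWM a') (hWM a) (hWe a')
      (hWe a) s).trans ?_
    have hsR := hs.2
    have hs0 := hs.1
    simp only [D]
    gcongr) r hr
  have h3 : 0 ≤ R ^ 2 * D := by positivity
  constructor <;> linarith

/-- Uniqueness at a rest point for the linear system satisfied by the slope and the radial
Laplacian. -/
lemma eq_zero_of_slope_eq_zero {k δ R : ℝ} {p W κ : ℝ → ℝ} (hk : 0 ≤ k) (hδ : 0 < δ)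
    (hR : δ ≤ R) (hp : ∀ r ∈ Icc δ R, HasDerivAt p (W r - k * (p r / r)) r)
    (hW : ∀ r ∈ Icc δ R, HasDerivAt W (p r * κ r) r) (hκ : ContinuousOn κ (Icc δ R))
    (hpR : p R = 0) (hWR : W R = 0) : p δ = 0 := by
  obtain ⟨K, hK⟩ := isCompact_Icc.exists_bound_of_continuousOn hκ
  set C := 2 * (k / δ) + 1 + K
  have hE : ∀ r ∈ Icc δ R, HasDerivAt (fun r => (p r ^ 2 + W r ^ 2) * exp (C * r))
      ((2 * p r * (W r - k * (p r / r)) + 2 * W r * (p r * κ r) + C * (p r ^ 2 + W r ^ 2))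
        * exp (C * r)) r := fun r hr => by
    have h1 : HasDerivAt (fun r => C * r) C r := by simpa using (hasDerivAt_id r).const_mul C
    refine ((((hp r hr).pow 2).add ((hW r hr).pow 2)).mul h1.exp).congr_deriv ?_
    simp
    ring
  have hmono := monotoneOn_of_hasDerivWithinAt_nonneg (convex_Icc δ R)
    (fun r hr => (hE r hr).continuousAt.continuousWithinAt)
    (fun r hr => (hE r (interior_subset hr)).hasDerivWithinAt) (fun r hr => by
      have hr := interior_subset hr
      refine mul_nonneg ?_ (exp_pos _).le
      have hr0 : 0 < r := hδ.trans_le hr.1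
      have h1 : k * (p r / r) * p r ≤ k / δ * p r ^ 2 := by
        have : k / r ≤ k / δ := div_le_div_of_nonneg_left hk hδ hr.1
        calc k * (p r / r) * p r = k / r * p r ^ 2 := by ring
          _ ≤ _ := mul_le_mul_of_nonneg_right this (sq_nonneg _)
      have h2 := abs_le.1 (hK r hr)
      have h4 : 0 ≤ k / δ := by positivity
      have h5 : 0 ≤ k / δ * W r ^ 2 := by positivity
      have h6 : 0 ≤ k / δ * p r ^ 2 := by positivity
      simp only [C]
      nlinarith [mul_nonneg (sub_nonneg.2 h2.2) (sq_nonneg (p r - W r)),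
        mul_nonneg (by linarith [h2.1] : 0 ≤ K + κ r) (sq_nonneg (p r + W r)),
        sq_nonneg (p r + W r), sq_nonneg (p r - W r)])
  have := hmono (left_mem_Icc.2 hR) (right_mem_Icc.2 hR) hR
  simp only [hpR, hWR] at this
  norm_num at this
  have h1 : p δ ^ 2 + W δ ^ 2 ≤ 0 := by
    by_contra! h
    linarith [mul_pos h (exp_pos (C * δ))]
  nlinarith [sq_nonneg (p δ), sq_nonneg (W δ)]

lemma exists_first_zero {v : ℝ → ℝ} (hv : Continuous v) (h0 : v 0 < 0)
    (h : ¬ ∀ r, 0 ≤ r → v r < 0) : ∃ R, 0 < R ∧ v R = 0 ∧ ∀ r ∈ Ico 0 R, v r < 0 := by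
  push Not at h
  obtain ⟨r, hr, hrv⟩ := h
  obtain ⟨s, ⟨hs, hsv⟩, hmin⟩ := (isCompact_Icc.inter_right
    (isClosed_le continuous_const hv : IsClosed {r | 0 ≤ v r})).exists_isLeast
      (⟨r, ⟨hr, le_rfl⟩, hrv⟩ : (Icc 0 r ∩ {r | 0 ≤ v r}).Nonempty)
  have hlt : ∀ t ∈ Ico 0 s, v t < 0 := fun t ht => by
    by_contra! h
    exact (hmin ⟨⟨ht.1, ht.2.le.trans hs.2⟩, h⟩).not_gt ht.2
  have hs0 : 0 < s := hs.1.lt_of_ne fun e => by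
    subst e
    exact h0.not_ge hsv
  refine ⟨s, hs0, le_antisymm ?_ hsv, hlt⟩
  have : s ∈ closure (Ico 0 s) := by
    rw [closure_Ico hs0.ne]
    exact right_mem_Icc.2 hs0.le
  exact closure_minimal (fun t ht => (hlt t ht).le) (isClosed_le hv continuous_const) this

lemma nonneg_of_hasDerivAt_of_nonpos_left {f : ℝ → ℝ} {f' R : ℝ} (hR : 0 < R)
    (hf : HasDerivAt f f' R) (hfR : f R = 0) (h : ∀ r ∈ Ico 0 R, f r ≤ 0) : 0 ≤ f' := by
  refine ge_of_tendsto ((hasDerivAt_iff_tendsto_slope.1 hf).mono_left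
    (nhdsWithin_mono R fun r (hr : r ∈ Iio R) => ne_of_lt hr)) ?_
  filter_upwards [Ioo_mem_nhdsLT hR] with r hr
  rw [slope_def_field, hfR, sub_zero]
  exact div_nonneg_of_nonpos (h r ⟨hr.1.le, hr.2⟩) (by linarith [hr.2])

lemma eventually_pos_of_hasDerivAt_pos {f : ℝ → ℝ} {f' R : ℝ} (hf : HasDerivAt f f' R)
    (hfR : f R = 0) (h : 0 < f') : ∀ᶠ r in 𝓝[>] R, 0 < f r := by
  have := ((hasDerivAt_iff_tendsto_slope.1 hf).mono_left
    (nhdsWithin_mono R fun r (hr : r ∈ Ioi R) => ne_of_gt hr)).eventually_const_lt h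
  filter_upwards [this, self_mem_nhdsWithin] with r hr hr'
  rw [slope_def_field, hfR, sub_zero] at hr
  exact (div_pos_iff_of_pos_right (sub_pos.2 hr')).1 hr

/-- The profile falls below the level `b` while decreasing. -/
def CrossesLevel (b : ℝ) (Q v : ℝ → ℝ) : Prop := ∃ r, 0 ≤ r ∧ Q r < b ∧ ∀ s ∈ Icc 0 r, v s < 0

/-- The profile starts to increase before reaching the level `b`. -/
def TurnsAboveLevel (b : ℝ) (Q v : ℝ → ℝ) : Prop :=
  ∃ r, 0 ≤ r ∧ 0 < v r ∧ ∀ s ∈ Icc 0 r, b < Q s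

lemma CrossesLevel.not_turnsAboveLevel {b : ℝ} {Q v : ℝ → ℝ} (h : CrossesLevel b Q v) :
    ¬ TurnsAboveLevel b Q v := by
  rintro ⟨s, hs, hvs, hQs⟩
  obtain ⟨r, hr, hQr, hvr⟩ := h
  rcases le_total r s with hrs | hsr
  · exact (hQs r ⟨hr, hrs⟩).not_gt hQr
  · exact (hvr s ⟨hs, hsr⟩).not_gt hvs

lemma exists_pos_add_lt_of_continuous {f : ℝ → ℝ} {c r : ℝ} (hf : Continuous f)
    (h : ∀ s ∈ Icc 0 r, f s < c) (hr : 0 ≤ r) : ∃ ε > 0, ∀ s ∈ Icc 0 r, f s + ε < c := by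
  obtain ⟨s, hs, hmax⟩ := isCompact_Icc.exists_isMaxOn ⟨r, right_mem_Icc.2 hr⟩ hf.continuousOn
  refine ⟨(c - f s) / 2, by linarith [h s hs], fun t ht => ?_⟩
  have h1 : f t ≤ f s := hmax ht
  linarith [h s hs]

section Family

variable {b : ℝ} {Q v : ℝ → ℝ → ℝ}

lemma isOpen_setOf_crossesLevel (hv : ∀ a, Continuous (v a))
    (h : ∀ a R ε, 0 ≤ R → 0 < ε → ∀ᶠ a' in 𝓝 a, ∀ r ∈ Icc 0 R,
      |v a' r - v a r| < ε ∧ |Q a' r - Q a r| < ε) :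
    IsOpen {a | CrossesLevel b (Q a) (v a)} := by
  refine isOpen_iff_mem_nhds.2 fun a ⟨r, hr, hQr, hvr⟩ => ?_
  obtain ⟨ε, hε, hvε⟩ := exists_pos_add_lt_of_continuous (hv a) hvr hr
  filter_upwards [h a r _ hr hε, h a r _ hr (sub_pos.2 hQr)] with a' h1 h2
  refine ⟨r, hr, ?_, fun s hs => ?_⟩
  · linarith [(abs_lt.1 (h2 r (right_mem_Icc.2 hr)).2).2]
  · linarith [(abs_lt.1 (h1 s hs).1).2, hvε s hs]

lemma isOpen_setOf_turnsAboveLevel (hQ : ∀ a, Continuous (Q a))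
    (h : ∀ a R ε, 0 ≤ R → 0 < ε → ∀ᶠ a' in 𝓝 a, ∀ r ∈ Icc 0 R,
      |v a' r - v a r| < ε ∧ |Q a' r - Q a r| < ε) :
    IsOpen {a | TurnsAboveLevel b (Q a) (v a)} := by
  refine isOpen_iff_mem_nhds.2 fun a ⟨r, hr, hvr, hQr⟩ => ?_
  obtain ⟨ε, hε, hQε⟩ := exists_pos_add_lt_of_continuous (hQ a).neg (c := -b)
    (fun s hs => neg_lt_neg (hQr s hs)) hr
  filter_upwards [h a r _ hr hε, h a r _ hr hvr] with a' h1 h2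
  refine ⟨r, hr, ?_, fun s hs => ?_⟩
  · linarith [(abs_lt.1 (h2 r (right_mem_Icc.2 hr)).1).1]
  · have := hQε s hs
    simp only [Pi.neg_apply] at this
    linarith [(abs_lt.1 (h1 s hs).2).1]

end Family

lemma le_of_not_crossesLevel {b R : ℝ} {Q v : ℝ → ℝ} (hQ : Continuous Q)
    (h : ¬ CrossesLevel b Q v) (hR : 0 < R) (hv : ∀ r ∈ Ico 0 R, v r < 0) :
    ∀ r ∈ Icc 0 R, b ≤ Q r := by
  intro r hr
  rw [← closure_Ico hR.ne] at hr
  refine closure_minimal (fun s hs => ?_) (isClosed_le continuous_const hQ) hr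
  by_contra hlt
  exact h ⟨s, hs.1, not_le.1 hlt, fun t ht => hv t ⟨ht.1, ht.2.trans_lt hs.2⟩⟩

section Shooting

variable {k : ℕ} {n x a b C M : ℝ} {W : ℝ → ℝ}

lemma crossesLevel_of_thirdIntegral_le {δ : ℝ} (hn : 1 < n)
    (hb : b ∈ Ioo (0 : ℝ) 1) (hM0 : 0 ≤ M) (hM : C < M)
    (hC : ∀ q ∈ Icc b 1, thirdIntegral n x a q ≤ C ∧
      -C ≤ firstIntegral n x a q - n * (secondIntegral n x a q * q ^ (-(n + 1))))
    (hs : IsVolterraSolution k (truncatedRHS k n x b M) a W) (ha : a < 0) (hδ : 0 < δ)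
    (h : ∀ q ∈ Icc b 1, thirdIntegral n x a q ≤ -δ) :
    CrossesLevel b (radialProfile k W) (radialAverage k W) := by
  have hc := continuous_truncatedRHS (k := k) (n := n) (x := x) hb.1 hb.2.le hM0
  have hk : (0 : ℝ) < k + 1 := by positivity
  by_contra hA
  by_cases hneg : ∀ r, 0 ≤ r → radialAverage k W r < 0
  · have hQb : ∀ r, 0 ≤ r → b ≤ radialProfile k W r := fun r hr =>
      le_of_not_crossesLevel (R := r + 1) (continuous_radialProfile hs.1) hA (by linarith)
        (fun s hs => hneg s hs.1) r ⟨hr, by linarith⟩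
    have hW : ∀ r, 0 ≤ r → W r ≤ -δ := fun r hr =>
      (integral_bounds_of_truncated hn hb hM0 hM hC hs hr (fun s hs => hQb s hs.1)
        fun s hs => (hneg s hs.1).le).2.trans (h _ ⟨hQb r hr, radialProfile_le_one hs.1 hr
          fun s hs => (hneg s hs.1).le⟩)
    have hv : ∀ r, 0 ≤ r → radialAverage k W r ≤ -δ / (k + 1) := fun r hr => by
      rw [← radialAverage_const k (-δ) r]
      exact radialAverage_mono hs.1 continuous_const fun t ht => hW _ (mul_nonneg ht.1 hr)
    have hQ : ∀ r, 0 ≤ r → radialProfile k W r ≤ 1 - δ / (k + 1) * (r ^ 2 / 2) := fun r hr => by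
      have := le_of_hasDerivAt_nonneg (f := fun r => -δ / (k + 1) * (r ^ 2 / 2)
        - radialProfile k W r) (f' := fun r => r * (-δ / (k + 1) - radialAverage k W r)) hr
        (fun s _ => by
          refine ((((hasDerivAt_pow 2 s).div_const 2).const_mul (-δ / ((k : ℝ) + 1))).sub
            (hasDerivAt_radialProfile hs.1 s)).congr_deriv ?_
          simp
          ring) fun s hs => mul_nonneg hs.1 (sub_nonneg.2 (hv s hs.1))
      simp only [radialProfile_zero] at this
      rw [neg_div] at this
      linarith
    have hcpos : 0 < δ / (k + 1) := by positivity
    have h1 := hQ (2 / (δ / (k + 1)) + 1) (by positivity)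
    have h2 := hQb (2 / (δ / (k + 1)) + 1) (by positivity)
    set c := δ / ((k : ℝ) + 1)
    have h3 : 0 < 2 / c := by positivity
    have h4 : c * (2 / c) = 2 := by field_simp
    have h5 : c * ((2 / c + 1) ^ 2 / 2) = 1 / c * (c * (2 / c)) + 2 + c / 2 := by
      field_simp
      ring
    have h6 : 0 < 1 / c * (c * (2 / c)) := by positivity
    linarith [hb.1]
  · obtain ⟨R, hR, hvR, hvlt⟩ := exists_first_zero (continuous_radialAverage hs.1)
      (by rw [radialAverage_zero, hs.apply_zero]; exact div_neg_of_neg_of_pos ha hk) hneg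
    have hQb := le_of_not_crossesLevel (continuous_radialProfile hs.1) hA hR hvlt
    have hv : ∀ r ∈ Icc 0 R, radialAverage k W r ≤ 0 := fun r hr => by
      rcases hr.2.eq_or_lt with e | e
      · rw [e, hvR]
      · exact (hvlt r ⟨hr.1, e⟩).le
    have h1 := (integral_bounds_of_truncated hn hb hM0 hM hC hs hR.le hQb hv).2
    have h2 := h _ ⟨hQb R (right_mem_Icc.2 hR.le), radialProfile_le_one hs.1 hR.le hv⟩
    have h3 := nonneg_of_hasDerivAt_of_nonpos_left hR (hs.hasDerivAt_slope hc R)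
      (by simp [hvR]) fun r hr => mul_nonpos_of_nonneg_of_nonpos hr.1 (hvlt r hr).le
    rw [hvR] at h3
    linarith

lemma not_crossesLevel_of_secondIntegral_neg {q : ℝ} (hn : 1 < n)
    (hb : b ∈ Ioo (0 : ℝ) 1) (hM0 : 0 ≤ M) (hM : C < M)
    (hC : ∀ q ∈ Icc b 1, thirdIntegral n x a q ≤ C ∧
      -C ≤ firstIntegral n x a q - n * (secondIntegral n x a q * q ^ (-(n + 1))))
    (hs : IsVolterraSolution k (truncatedRHS k n x b M) a W) (hq : q ∈ Ioo b 1)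
    (h : secondIntegral n x a q < 0) :
    ¬ CrossesLevel b (radialProfile k W) (radialAverage k W) := by
  rintro ⟨r, hr, hQr, hvr⟩
  have hanti := antitoneOn_radialProfile hs.1 fun s hs => (hvr s hs).le
  obtain ⟨s, hsr, hsq⟩ := intermediate_value_Icc' hr
    (continuous_radialProfile (k := k) hs.1).continuousOn
    (show q ∈ Icc (radialProfile k W r) (radialProfile k W 0) by
      rw [radialProfile_zero]
      exact ⟨hQr.le.trans hq.1.le, hq.2.le⟩)
  have key := (integral_bounds_of_truncated hn hb hM0 hM hC hs hsr.1 (fun t ht => by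
    have := hanti ⟨ht.1, ht.2.trans hsr.2⟩ hsr ht.2
    rw [hsq] at this
    exact hq.1.le.trans this) fun t ht => (hvr t ⟨ht.1, ht.2.trans hsr.2⟩).le).1
  rw [hsq] at key
  exact key.not_gt h

lemma radialAverage_neg_of_not_crossesLevel (hn : 1 < n)
    (hb : b ∈ Ioo (0 : ℝ) 1) (hM0 : 0 ≤ M) (hM : C < M)
    (hC : ∀ q ∈ Icc b 1, thirdIntegral n x a q ≤ C ∧
      -C ≤ firstIntegral n x a q - n * (secondIntegral n x a q * q ^ (-(n + 1))))
    (hs : IsVolterraSolution k (truncatedRHS k n x b M) a W) (ha : a < 0)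
    (h : thirdIntegral n x a b < 0)
    (hA : ¬ CrossesLevel b (radialProfile k W) (radialAverage k W))
    (hB : ¬ TurnsAboveLevel b (radialProfile k W) (radialAverage k W)) :
    ∀ r, 0 ≤ r → radialAverage k W r < 0 := by
  have hc := continuous_truncatedRHS (k := k) (n := n) (x := x) hb.1 hb.2.le hM0
  have hk : (0 : ℝ) < k + 1 := by positivity
  have hQc := continuous_radialProfile (k := k) hs.1
  by_contra hneg
  obtain ⟨R, hR, hvR, hvlt⟩ := exists_first_zero (continuous_radialAverage hs.1)
    (by rw [radialAverage_zero, hs.apply_zero]; exact div_neg_of_neg_of_pos ha hk) hneg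
  have hQb := le_of_not_crossesLevel hQc hA hR hvlt
  have hv : ∀ r ∈ Icc 0 R, radialAverage k W r ≤ 0 := fun r hr => by
    rcases hr.2.eq_or_lt with e | e
    · rw [e, hvR]
    · exact (hvlt r ⟨hr.1, e⟩).le
  have hWle := (integral_bounds_of_truncated hn hb hM0 hM hC hs hR.le hQb hv).2
  have hslope := hs.hasDerivAt_slope hc R
  rw [hvR, mul_zero, sub_zero] at hslope
  have hW0 := nonneg_of_hasDerivAt_of_nonpos_left hR hslope
    (by simp [hvR]) fun r hr => mul_nonpos_of_nonneg_of_nonpos hr.1 (hvlt r hr).le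
  have hRmem := right_mem_Icc.2 hR.le
  rcases (hQb R hRmem).eq_or_lt with hbR | hbR
  · rw [← hbR] at hWle
    linarith
  rcases hW0.eq_or_lt with hW0 | hW0
  · have hpos : ∀ r ∈ Icc (R / 2) R, r ∈ Icc 0 R ∧ 0 < r := fun r hr =>
      ⟨⟨by linarith [hr.1], hr.2⟩, by linarith [hr.1]⟩
    have hQ0 : ∀ r ∈ Icc (R / 2) R, radialProfile k W r ≠ 0 := fun r hr =>
      (hb.1.trans_le (hQb r (hpos r hr).1)).ne'
    have := eq_zero_of_slope_eq_zero (k := k) (δ := R / 2) (R := R) (W := W)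
      (p := fun r => r * radialAverage k W r)
      (κ := fun r => radialProfile k W r ^ (-n) - n * x / radialProfile k W r
        - n / radialProfile k W r * (W r - k * radialAverage k W r))
      (Nat.cast_nonneg k) (by linarith) (by linarith)
      (fun r hr => by
        refine (hs.hasDerivAt_slope hc r).congr_deriv ?_
        rw [mul_div_cancel_left₀ _ (hpos r hr).2.ne'])
      (fun r hr => by
        refine (abs_le_of_truncated hn hb hM0 hM hC hs hQb hv r (hpos r hr).1).2.congr_deriv ?_
        unfold magmaRHS
        ring)
      (((hQc.continuousOn.rpow_const fun r hr => Or.inl (hQ0 r hr)).sub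
        (continuousOn_const.div hQc.continuousOn hQ0)).sub
        ((continuousOn_const.div hQc.continuousOn hQ0).mul
          (hs.1.sub (continuous_const.mul (continuous_radialAverage hs.1))).continuousOn))
      (by simp [hvR]) hW0.symm
    rcases mul_eq_zero.1 this with e | e
    · linarith
    · exact (hvlt (R / 2) ⟨by linarith, by linarith⟩).ne e
  · obtain ⟨l, u, hlu, hsub⟩ := mem_nhds_iff_exists_Ioo_subset.1
      (hQc.continuousAt.eventually (lt_mem_nhds hbR))
    obtain ⟨r, hrp, hr⟩ := ((eventually_pos_of_hasDerivAt_pos hslope (by simp [hvR]) hW0).and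
      (Ioo_mem_nhdsGT hlu.2)).exists
    have hr0 : 0 < r := hR.trans hr.1
    refine hB ⟨r, hr0.le, (pos_iff_pos_of_mul_pos hrp).1 hr0, fun s hs' => ?_⟩
    rcases le_total s R with hsR | hsR
    · exact hbR.trans_le (antitoneOn_radialProfile hs.1 hv ⟨hs'.1, hsR⟩ hRmem hsR)
    · exact hsub ⟨hlu.1.trans_le hsR, hs'.2.trans_lt hr.2⟩

end Shooting

lemma magmaODE_radialProfile {k : ℕ} {n c a r : ℝ} {h : ℝ → ℝ → ℝ → ℝ} {W : ℝ → ℝ}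
    (hs : IsVolterraSolution k h a W) (hc : Continuous fun p : ℝ × ℝ × ℝ => h p.1 p.2.1 p.2.2)
    (hr : 0 < r) (hQ : 0 < radialProfile k W r)
    (hW : HasDerivAt W
      (r * magmaRHS k n (1 / c) (radialProfile k W r) (W r) (radialAverage k W r)) r) :
    magmaODE ((k + 1 : ℕ) : ℝ) n c (radialProfile k W) r := by
  obtain ⟨v', -, hv, -⟩ := hs.exists_hasDerivAt_radialAverage hc
  have hQn := (hasDerivAt_radialProfile (k := k) hs.1 r).rpow_const (p := n) (Or.inl hQ.ne')
  have hlap := hQn.mul (hW.sub ((hv r).const_mul (k : ℝ)))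
  have hquot : (fun s => s * radialAverage k W s / s) =ᶠ[𝓝 r] radialAverage k W := by
    filter_upwards [lt_mem_nhds hr] with s hs'
    rw [mul_div_cancel_left₀ _ hs'.ne']
  unfold magmaODE
  rw [hs.deriv_deriv_profile hc, hs.deriv_profile, hQn.deriv, hquot.deriv_eq, (hv r).deriv]
  rw [show deriv (fun s => radialProfile k W s ^ n * (fun r => W r - k * radialAverage k W r) s) r
    = _ from hlap.deriv]
  have e : radialProfile k W r ^ (-n) * radialProfile k W r ^ n = 1 := by
    rw [← Real.rpow_add hQ, neg_add_cancel, Real.rpow_zero]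
  rw [Real.rpow_sub_one hQ.ne']
  unfold magmaRHS
  push_cast
  simp only [Pi.sub_apply]
  linear_combination r * radialAverage k W r * e

lemma exists_tendsto_radialProfile {k : ℕ} {b : ℝ} {W : ℝ → ℝ} (hW : Continuous W) (hb : 0 < b)
    (hQ : ∀ r, 0 ≤ r → b ≤ radialProfile k W r) (hv : ∀ r, 0 ≤ r → radialAverage k W r < 0) :
    ∃ L, Tendsto (radialProfile k W) atTop (𝓝 L) ∧ 0 < L ∧ L < 1 := by
  have hanti : StrictAntiOn (radialProfile k W) (Ici 0) :=
    strictAntiOn_of_deriv_neg (convex_Ici 0) (continuous_radialProfile hW).continuousOn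
      fun r hr => by
        rw [interior_Ici] at hr
        rw [(hasDerivAt_radialProfile hW r).deriv]
        exact mul_neg_of_pos_of_neg hr (hv r (le_of_lt hr))
  have hmax : Antitone fun r => radialProfile k W (max 0 r) := fun r s hrs =>
    hanti.antitoneOn (mem_Ici.2 (le_max_left _ _)) (mem_Ici.2 (le_max_left _ _))
      (max_le_max_left 0 hrs)
  have hlim := tendsto_atTop_ciInf hmax ⟨b, by
    rintro _ ⟨r, rfl⟩
    exact hQ _ (le_max_left _ _)⟩
  refine ⟨_, hlim.congr' ?_, hb.trans_le (ge_of_tendsto' hlim fun r => hQ _ (le_max_left _ _)), ?_⟩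
  · filter_upwards [eventually_ge_atTop 0] with r hr
    rw [max_eq_right hr]
  · refine (le_of_tendsto hlim ((eventually_ge_atTop 1).mono fun r hr => hmax hr)).trans_lt ?_
    have := hanti (mem_Ici.2 le_rfl) (mem_Ici.2 zero_le_one) one_pos
    rw [radialProfile_zero] at this
    simpa using this

/-- Shooting: some initial value yields a solution that decreases forever while staying above the
level `b`. -/
lemma exists_shooting_value {k : ℕ} {n x : ℝ} (hn : n ∈ Icc (2 : ℝ) 3) (hx : 0 ≤ x)
    (hx' : x ≤ 20 / 31) (hnx : 1 < n * x) :
    ∃ a < 0, ∃ b ∈ Ioo (0 : ℝ) 1, ∃ M, 0 ≤ M ∧ ∃ W,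
      IsVolterraSolution k (truncatedRHS k n x b M) a W ∧ ∀ r, 0 ≤ r →
        b ≤ radialProfile k W r ∧ radialAverage k W r < 0 ∧ HasDerivAt W
          (r * magmaRHS k n x (radialProfile k W r) (W r) (radialAverage k W r)) r := by
  have hn1 : 1 < n := by linarith [hn.1]
  obtain ⟨b, hb, hcoeff, hneg⟩ := exists_critical_level hn hx hx'
  obtain ⟨a₀, ha₀, δ, hδ, hthird⟩ := exists_thirdIntegral_neg hn1 hb hcoeff (hneg 0)
  obtain ⟨q, hq, a₁, ha₁, hsecond⟩ := exists_secondIntegral_neg hn1 hb hnx ha₀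
  obtain ⟨C, hC⟩ := exists_bound_integrals (x := x) (a₀ := a₀) hn1 hb.1
  have hM0 : 0 ≤ |C| + 1 := by positivity
  have hM : C < |C| + 1 := by linarith [le_abs_self C]
  obtain ⟨W, hW, hcont⟩ := exists_truncated_family (k := k) (n := n) (x := x) hb hM0
  have hcross : CrossesLevel b (radialProfile k (W a₀)) (radialAverage k (W a₀)) :=
    crossesLevel_of_thirdIntegral_le hn1 hb hM0 hM (hC a₀ ⟨le_rfl, ha₀.le⟩) (hW a₀) ha₀ hδ hthird
  have hnot : ¬ CrossesLevel b (radialProfile k (W a₁)) (radialAverage k (W a₁)) :=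
    not_crossesLevel_of_secondIntegral_neg hn1 hb hM0 hM (hC a₁ ⟨ha₁.1.le, ha₁.2.le⟩) (hW a₁) hq
      hsecond
  obtain ⟨a, ha, hA, hB⟩ : ∃ a ∈ Icc a₀ a₁,
      ¬ CrossesLevel b (radialProfile k (W a)) (radialAverage k (W a)) ∧
      ¬ TurnsAboveLevel b (radialProfile k (W a)) (radialAverage k (W a)) := by
    by_contra! h
    obtain ⟨a, -, hA, hB⟩ := isPreconnected_Icc (a := a₀) (b := a₁) _ _
      (isOpen_setOf_crossesLevel (b := b) (fun a => continuous_radialAverage (hW a).1) hcont)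
      (isOpen_setOf_turnsAboveLevel (b := b) (fun a => continuous_radialProfile (hW a).1) hcont)
      (fun a ha => or_iff_not_imp_left.2 (h a ha)) ⟨a₀, left_mem_Icc.2 ha₁.1.le, hcross⟩
      ⟨a₁, right_mem_Icc.2 ha₁.1.le, h a₁ (right_mem_Icc.2 ha₁.1.le) hnot⟩
    exact CrossesLevel.not_turnsAboveLevel hA hB
  have ha0 : a < 0 := ha.2.trans_lt ha₁.2
  have hCa := hC a ⟨ha.1, ha0.le⟩
  have hv := radialAverage_neg_of_not_crossesLevel hn1 hb hM0 hM hCa (hW a) ha0 (hneg a) hA hB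
  have hQ : ∀ r, 0 ≤ r → b ≤ radialProfile k (W a) r := fun r hr =>
    le_of_not_crossesLevel (R := r + 1) (continuous_radialProfile (hW a).1) hA (by linarith)
      (fun s hs => hv s hs.1) r ⟨hr, by linarith⟩
  exact ⟨a, ha0, b, hb, _, hM0, W a, hW a, fun r hr => ⟨hQ r hr, hv r hr,
    (abs_le_of_truncated hn1 hb hM0 hM hCa (hW a) (fun s hs => hQ s hs.1)
      (fun s hs => (hv s hs.1).le) r ⟨hr, le_rfl⟩).2⟩⟩

/-- Existence of a monotone, positive solitary-wave profile for the rescaled IVP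
(Proposition on existence of solitary waves). -/
theorem magma_solitary_wave_existence
    (d : ℕ) (hd : 1 ≤ d) (n c : ℝ) (hn : n ∈ Icc (2:ℝ) 3) (hc : c ∈ Ico (1.55:ℝ) n) :
    ∃ μc : ℝ, μc < 0 ∧ ∃ Q : ℝ → ℝ, isIVPSolution (d:ℝ) n c μc Q ∧
      (∀ r : ℝ, 0 < r → 0 < Q r ∧ deriv Q r < 0) ∧
      ∃ L : ℝ, Tendsto Q atTop (𝓝 L) ∧ 0 < L ∧ L < 1 := by
  obtain ⟨k, rfl⟩ := Nat.exists_eq_add_of_le' hd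
  have hc1 : (1.55 : ℝ) ≤ c := hc.1
  have hc0 : 0 < c := by linarith
  have hk : (0 : ℝ) < k + 1 := by positivity
  obtain ⟨a, ha, b, hb, M, hM, W, hW, hsol⟩ := exists_shooting_value (k := k) (x := 1 / c) hn
    (by positivity) (by rw [div_le_iff₀ hc0]; linarith)
    (by rw [mul_one_div, lt_div_iff₀ hc0, one_mul]; exact hc.2)
  have hcont := continuous_truncatedRHS (k := k) (n := n) (x := 1 / c) hb.1 hb.2.le hM
  refine ⟨a / (k + 1), div_neg_of_neg_of_pos ha hk, radialProfile k W,
    ⟨(hW.contDiff_profile hcont).contDiffOn, fun r hr => ?_, radialProfile_zero k W, ?_, ?_⟩,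
    fun r hr => ⟨hb.1.trans_le (hsol r hr.le).1, ?_⟩,
    exists_tendsto_radialProfile hW.1 hb.1 (fun r hr => (hsol r hr).1) fun r hr => (hsol r hr).2.1⟩
  · exact magmaODE_radialProfile hW hcont hr (hb.1.trans_le (hsol r hr.le).1) (hsol r hr.le).2.2
  · rw [hW.deriv_profile]
    exact zero_mul _
  · rw [hW.deriv_deriv_profile hcont]
    simp only [radialAverage_zero, hW.apply_zero]
    field_simp
    ring
  · rw [hW.deriv_profile]
    exact mul_neg_of_pos_of_neg hr (hsol r hr.le).2.1
end
end

section
/- Let d ≥ 1, n ∈ [2,3], c ∈ [1.55, n), μ < 0, and let Q be a solution of the IVP that is C³ on [0,τ) with Q(r) > 0 and Q_r(r) < 0 for all r ∈ (0,τ), where τ > 0. Then for every r ∈ (0,τ): Q_rr(r) + n Q_r(r)²/(2 Q(r)) = F₁(Q(r), μ) − (n/2) ∫₀^r Q_r(s)³ / Q(s)² ds − (d−1) Q_r(r)/r. -/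
open Set Filter Topology intervalIntegral Real

noncomputable section

/-- The derivative of a `C^(m+1)` function on `[0, τ)` is `C^m` on `[0, τ)`, endpoint included, as
soon as it is continuous at `0`. -/
theorem contDiffOn_deriv_Ico {f : ℝ → ℝ} {τ : ℝ} {m : ℕ} (hτ : 0 < τ)
    (hf : ContDiffOn ℝ (m + 1) f (Ico 0 τ)) (hcont : ContinuousAt (deriv f) 0) :
    ContDiffOn ℝ m (deriv f) (Ico 0 τ) := by
  have hS : UniqueDiffOn ℝ (Ico (0:ℝ) τ) := uniqueDiffOn_Ico 0 τ
  have hP : ContDiffOn ℝ m (derivWithin f (Ico 0 τ)) (Ico 0 τ) :=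
    hf.derivWithin hS le_rfl
  have hint : ∀ x ∈ Ioo (0:ℝ) τ, deriv f x = derivWithin f (Ico 0 τ) x := fun x hx =>
    (derivWithin_of_mem_nhds (Ico_mem_nhds hx.1 hx.2)).symm
  have hzero : deriv f 0 = derivWithin f (Ico 0 τ) 0 := by
    have h1 : Tendsto (deriv f) (𝓝[>] 0) (𝓝 (deriv f 0)) :=
      hcont.tendsto.mono_left nhdsWithin_le_nhds
    have h2 : Tendsto (derivWithin f (Ico 0 τ)) (𝓝[>] 0) (𝓝 (derivWithin f (Ico 0 τ) 0)) := by
      have h := hP.continuousOn 0 ⟨le_rfl, hτ⟩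
      rw [← nhdsWithin_Ioo_eq_nhdsGT hτ]
      exact h.tendsto.mono_left (nhdsWithin_mono _ Ioo_subset_Ico_self)
    refine tendsto_nhds_unique h1 (h2.congr' ?_)
    filter_upwards [Ioo_mem_nhdsGT hτ] with x hx using (hint x hx).symm
  refine hP.congr fun x hx => ?_
  rcases hx.1.eq_or_lt with h | h
  · rw [← h, hzero]
  · exact hint x ⟨h, hx.2⟩

/-- A `C^(m+1)` function on `[0, τ)` that is differentiable at `0` has a `C^m` derivative there. -/
theorem contDiffOn_deriv_Ico_of_differentiableAt {f : ℝ → ℝ} {τ : ℝ} {m : ℕ}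
    (hf : ContDiffOn ℝ (m + 1) f (Ico 0 τ)) (hdiff : DifferentiableAt ℝ f 0) :
    ContDiffOn ℝ m (deriv f) (Ico 0 τ) := by
  have hS : UniqueDiffOn ℝ (Ico (0:ℝ) τ) := uniqueDiffOn_Ico 0 τ
  refine (hf.derivWithin hS le_rfl).congr fun x hx => ?_
  rcases hx.1.eq_or_lt with h | h
  · subst h
    exact (hdiff.derivWithin (hS 0 hx)).symm
  · exact (derivWithin_of_mem_nhds (Ico_mem_nhds h hx.2)).symm

theorem ContDiffOn.hasDerivAt_Ioo {f : ℝ → ℝ} {a b x : ℝ} {m : ℕ}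
    (hf : ContDiffOn ℝ (m + 1) f (Ico a b)) (hx : x ∈ Ioo a b) :
    HasDerivAt f (deriv f x) x :=
  ((hf.contDiffAt (Ico_mem_nhds hx.1 hx.2)).differentiableAt (by simp)).hasDerivAt

/-- The magma equation divided by `Qⁿ`. -/
theorem magmaODE.divided {d n c : ℝ} {Q : ℝ → ℝ} {r q₃ : ℝ} (h : magmaODE d n c Q r)
    (hr : r ≠ 0) (hQ : 0 < Q r) (h₁ : HasDerivAt Q (deriv Q r) r)
    (h₂ : HasDerivAt (deriv Q) (deriv (deriv Q) r) r)
    (h₃ : HasDerivAt (deriv (deriv Q)) q₃ r) :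
    q₃ + n * deriv Q r * deriv (deriv Q) r / Q r - Q r ^ (-n) * deriv Q r
      + n / c * (deriv Q r / Q r)
      + (d - 1) * ((deriv (deriv Q) r * r - deriv Q r) / r ^ 2) = 0 := by
  have hpow : HasDerivAt (fun s => Q s ^ n) (deriv Q r * n * Q r ^ (n - 1)) r :=
    h₁.rpow_const (Or.inl hQ.ne')
  have hdiv := h₂.div (hasDerivAt_id r) hr
  unfold magmaODE at h
  rw [hpow.deriv, show (fun s => Q s ^ n * deriv (deriv Q) s) = (fun s => Q s ^ n) * deriv (deriv Q)
    from rfl, (hpow.mul h₃).deriv, show (fun s => deriv Q s / s) = deriv Q / id from rfl,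
    hdiv.deriv, rpow_sub_one hQ.ne'] at h
  have hQn : Q r ^ n ≠ 0 := (rpow_pos_of_pos hQ n).ne'
  rw [rpow_neg hQ.le]
  refine (mul_eq_zero.1 (?_ : Q r ^ n * _ = 0)).resolve_left hQn
  rw [← h]
  simp only [id, mul_one]
  field_simp
  ring

theorem hasDerivAt_F1_comp {d n c μ : ℝ} {Q : ℝ → ℝ} {r q : ℝ} (hn : n ≠ 1) (hQ : 0 < Q r)
    (h₁ : HasDerivAt Q q r) :
    HasDerivAt (fun s => F1 d n c (Q s) μ) (Q r ^ (-n) * q - n / c * (q / Q r)) r := by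
  have hpow : HasDerivAt (fun s => Q s ^ (1 - n)) (q * (1 - n) * Q r ^ (1 - n - 1)) r :=
    h₁.rpow_const (Or.inl hQ.ne')
  have h := (((hpow.sub_const 1).const_mul (-(1 / (n - 1)))).sub
    ((h₁.log hQ.ne').const_mul (n / c))).add_const (μ * d)
  refine h.congr_deriv ?_
  rw [show 1 - n - 1 = -n by ring]
  have : n - 1 ≠ 0 := sub_ne_zero.2 hn
  field_simp
  ring

/-- The first-integral identity (equation (Qrr) in the paper). -/
theorem magma_first_integral_identity
    (d n c μ τ : ℝ) (hd : 1 ≤ d) (hn : n ∈ Icc (2:ℝ) 3) (hc : c ∈ Ico (1.55:ℝ) n)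
    (hμ : μ < 0) (hτ : 0 < τ) (Q : ℝ → ℝ)
    (hreg : ContDiffOn ℝ 3 Q (Ico 0 τ))
    (hode : ∀ r ∈ Ioo (0:ℝ) τ, magmaODE d n c Q r)
    (hQ0 : Q 0 = 1) (hQr0 : deriv Q 0 = 0) (hQrr0 : deriv (deriv Q) 0 = μ)
    (hpos : ∀ r ∈ Ioo (0:ℝ) τ, 0 < Q r) (hdec : ∀ r ∈ Ioo (0:ℝ) τ, deriv Q r < 0) :
    ∀ r ∈ Ioo (0:ℝ) τ,
      deriv (deriv Q) r + n * (deriv Q r) ^ 2 / (2 * Q r)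
        = F1 d n c (Q r) μ - (n / 2) * (∫ s in (0:ℝ)..r, (deriv Q s) ^ 3 / (Q s) ^ 2)
          - (d - 1) * deriv Q r / r := by
  have hdiff : DifferentiableAt ℝ (deriv Q) 0 :=
    differentiableAt_of_deriv_ne_zero (hQrr0.trans_ne hμ.ne)
  have hQ₀ : ContDiffOn ℝ ((2 : ℕ) + 1) Q (Ico 0 τ) := by
    convert hreg using 1
    norm_num
  have hQ₁ : ContDiffOn ℝ ((1 : ℕ) + 1) (deriv Q) (Ico 0 τ) := by
    convert contDiffOn_deriv_Ico hτ hQ₀ hdiff.continuousAt using 1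
    norm_num
  have hQ₂ : ContDiffOn ℝ ((0 : ℕ) + 1) (deriv (deriv Q)) (Ico 0 τ) := by
    convert contDiffOn_deriv_Ico_of_differentiableAt hQ₁ hdiff using 1
    norm_num
  have hn1 : n ≠ 1 := by linarith [hn.1]
  have h0 : (0:ℝ) ∈ Ico 0 τ := ⟨le_rfl, hτ⟩
  have hposS : ∀ r ∈ Ico (0:ℝ) τ, 0 < Q r := fun r hr => by
    rcases hr.1.eq_or_lt with h | h
    · rw [← h, hQ0]
      exact one_pos
    · exact hpos r ⟨h, hr.2⟩
  have hg : ContinuousOn (fun s => (deriv Q s) ^ 3 / (Q s) ^ 2) (Ico 0 τ) :=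
    (hQ₁.continuousOn.pow 3).div (hQ₀.continuousOn.pow 2)
      fun r hr => (pow_pos (hposS r hr) 2).ne'
  set I : ℝ → ℝ := fun r => ∫ s in (0:ℝ)..r, (deriv Q s) ^ 3 / (Q s) ^ 2 with hI
  have hgint : ∀ b ∈ Ico (0:ℝ) τ, IntervalIntegrable
      (fun s => (deriv Q s) ^ 3 / (Q s) ^ 2) MeasureTheory.volume 0 b := fun b hb =>
    (hg.mono (by rw [uIcc_of_le hb.1]; exact Icc_subset_Ico_right hb.2)).intervalIntegrable
  have hIderiv : ∀ r ∈ Ioo (0:ℝ) τ, HasDerivAt I ((deriv Q r) ^ 3 / (Q r) ^ 2) r := fun r hr =>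
    integral_hasDerivAt_right (hgint r (Ioo_subset_Ico_self hr))
      ((hg.mono Ioo_subset_Ico_self).stronglyMeasurableAtFilter isOpen_Ioo r hr)
      (hg.continuousAt (Ico_mem_nhds hr.1 hr.2))
  have hIzero : Tendsto I (𝓝[>] 0) (𝓝 0) := by
    have hb : τ / 2 ∈ Ico (0:ℝ) τ := ⟨by linarith, by linarith⟩
    have h := continuousOn_primitive_interval'
      (hgint (τ / 2) hb) (left_mem_uIcc) 0 left_mem_uIcc
    have h' := h.tendsto.mono_left (nhdsWithin_mono 0
      ((Ioo_subset_Icc_self (a := (0:ℝ)) (b := τ / 2)).trans Icc_subset_uIcc))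
    rwa [nhdsWithin_Ioo_eq_nhdsGT (by linarith), integral_same] at h'
  set G : ℝ → ℝ := fun r => deriv (deriv Q) r + n / 2 * ((deriv Q r) ^ 2 / Q r)
    - F1 d n c (Q r) μ + n / 2 * I r + (d - 1) * (deriv Q r / r) with hG
  have hGderiv : ∀ r ∈ Ioo (0:ℝ) τ, HasDerivAt G 0 r := fun r hr => by
    have h₁ := hQ₀.hasDerivAt_Ioo hr
    have h₂ := hQ₁.hasDerivAt_Ioo hr
    have h₃ := hQ₂.hasDerivAt_Ioo hr
    have hQr := hpos r hr
    have key := (hode r hr).divided hr.1.ne' hQr h₁ h₂ h₃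
    have h := (((h₃.add (((h₂.pow 2).div h₁ hQr.ne').const_mul (n / 2))).sub
      (hasDerivAt_F1_comp (d := d) (c := c) (μ := μ) hn1 hQr h₁)).add
      ((hIderiv r hr).const_mul (n / 2))).add
      ((h₂.div (hasDerivAt_id r) hr.1.ne').const_mul (d - 1))
    refine h.congr_deriv ?_
    rw [← key]
    simp only [id, mul_one, Pi.pow_apply]
    have hr0 := hr.1.ne'
    have hne := hQr.ne'
    generalize Q r ^ (-n) = A
    generalize n / c = B
    field_simp
    ring
  have hright : ∀ {f : ℝ → ℝ}, ContinuousOn f (Ico 0 τ) → Tendsto f (𝓝[>] 0) (𝓝 (f 0)) :=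
    fun hf => by
      rw [← nhdsWithin_Ioo_eq_nhdsGT hτ]
      exact (hf 0 h0).tendsto.mono_left (nhdsWithin_mono _ Ioo_subset_Ico_self)
  have hGzero : Tendsto G (𝓝[>] 0) (𝓝 0) := by
    have t₀ := hright hQ₀.continuousOn
    have t₁ := hright hQ₁.continuousOn
    have t₂ := hright hQ₂.continuousOn
    have tF : Tendsto (fun s => F1 d n c (Q s) μ) (𝓝[>] 0) (𝓝 (F1 d n c (Q 0) μ)) := by
      have hQpos : 0 < id (Q 0) := hposS 0 h0
      exact (hasDerivAt_F1_comp (Q := id) hn1 hQpos (hasDerivAt_id _)).continuousAt.tendsto.comp t₀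
    have tslope : Tendsto (fun s => deriv Q s / s) (𝓝[>] 0) (𝓝 μ) := by
      have h := hdiff.hasDerivAt.tendsto_slope_zero_right
      rw [hQrr0] at h
      simpa [hQr0, div_eq_inv_mul] using h
    have h := (((t₂.add (((t₁.pow 2).div t₀ (hposS 0 h0).ne').const_mul (n / 2))).sub tF).add
      (hIzero.const_mul (n / 2))).add (tslope.const_mul (d - 1))
    have hval : deriv (deriv Q) 0 + n / 2 * (deriv Q 0 ^ 2 / Q 0) - F1 d n c (Q 0) μ + n / 2 * 0
        + (d - 1) * μ = 0 := by
      rw [hQ0, hQr0, hQrr0]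
      simp [F1]
      ring
    rwa [hval] at h
  intro r hr
  have hGr : G r = 0 := by
    refine tendsto_nhds_unique (tendsto_const_nhds.congr' ?_) hGzero
    filter_upwards [Ioo_mem_nhdsGT hτ] with x hx
    exact isOpen_Ioo.is_const_of_deriv_eq_zero isPreconnected_Ioo
      (fun y hy => (hGderiv y hy).differentiableAt.differentiableWithinAt)
      (fun y hy => (hGderiv y hy).deriv) hr hx
  have hQr := (hpos r hr).ne'
  have hr0 := hr.1.ne'
  have e₁ : n * (deriv Q r) ^ 2 / (2 * Q r) = n / 2 * ((deriv Q r) ^ 2 / Q r) := by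
    field_simp
  rw [e₁, mul_div_assoc (d - 1)]
  simp only [hG, hI] at hGr
  linarith
end
end

section
/- Let d ≥ 1, n ∈ [2,3], c ∈ [1.55, n), μ < 0, and let Q be a solution of the IVP that is C³ on [0,τ) with Q(r) > 0 and Q_r(r) < 0 for all r ∈ (0,τ), where τ > 0. Then for every r ∈ (0,τ): Q_r(r)² < 2 F₂(Q(r), μ) Q(r)^{−n}. -/
open Set Filter Topology intervalIntegral Real

noncomputable section

lemma pos_of_deriv_pos_of_tendsto_zero {f f' : ℝ → ℝ} {τ : ℝ}
    (hf : ∀ r ∈ Ioo (0:ℝ) τ, HasDerivAt f (f' r) r) (hf' : ∀ r ∈ Ioo (0:ℝ) τ, 0 < f' r)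
    (h0 : Tendsto f (𝓝[>] 0) (𝓝 0)) : ∀ r ∈ Ioo (0:ℝ) τ, 0 < f r := by
  intro r hr
  have hmono : StrictMonoOn f (Ioo 0 τ) := by
    refine strictMonoOn_of_deriv_pos (convex_Ioo 0 τ)
      (fun x hx => (hf x hx).continuousAt.continuousWithinAt) fun x hx => ?_
    rw [interior_Ioo] at hx
    rw [(hf x hx).deriv]
    exact hf' x hx
  have hr2 : r / 2 ∈ Ioo (0:ℝ) τ := ⟨by linarith [hr.1], by linarith [hr.1, hr.2]⟩
  have hle : 0 ≤ f (r / 2) := by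
    refine le_of_tendsto h0 ?_
    filter_upwards [Ioo_mem_nhdsGT hr2.1] with s hs
    exact (hmono ⟨hs.1, hs.2.trans hr2.2⟩ hr2 hs.2).le
  exact hle.trans_lt (hmono hr2 hr (by linarith [hr.1]))

lemma hasDerivAt_F1 {d n c μ q : ℝ} (hn : n ≠ 1) (hq : 0 < q) :
    HasDerivAt (fun x => F1 d n c x μ) (q ^ (-n) - n / c * q⁻¹) q := by
  have h1 := (Real.hasDerivAt_rpow_const (p := 1 - n) (Or.inl hq.ne'))
  have h := (((h1.sub_const 1).const_mul (-(1 / (n - 1)))).sub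
    ((Real.hasDerivAt_log hq.ne').const_mul (n / c))).add_const (μ * d)
  refine h.congr_deriv ?_
  have : n - 1 ≠ 0 := sub_ne_zero.mpr hn
  rw [show 1 - n - 1 = -n by ring]
  field_simp
  ring

lemma hasDerivAt_F2 {d n c μ q : ℝ} (hn : n ≠ 1) (hq : 0 < q) :
    HasDerivAt (fun x => F2 d n c x μ) (F1 d n c q μ * q ^ n) q := by
  have hcont : ContinuousOn (fun x => F1 d n c x μ * x ^ n) (Ioi 0) := fun x hx =>
    ((hasDerivAt_F1 hn hx).continuousAt.mul
      (Real.continuousAt_rpow_const x n (Or.inl (ne_of_gt hx)))).continuousWithinAt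
  refine integral_hasDerivAt_right ?_ ?_ (hcont.continuousAt (Ioi_mem_nhds hq))
  · refine (hcont.mono fun x hx => ?_).intervalIntegrable
    exact (lt_min one_pos hq).trans_le hx.1
  · exact hcont.stronglyMeasurableAtFilter isOpen_Ioi q hq

/-- The classical two-sided derivatives of a function that is `C³` up to the endpoint `0` are
right-continuous there, as soon as the second one does not vanish. -/
lemma tendsto_derivs_nhdsGT_zero {Q : ℝ → ℝ} {τ μ : ℝ} (hτ : 0 < τ) (hμ : μ ≠ 0)
    (hreg : ContDiffOn ℝ 3 Q (Ico 0 τ)) (hQr0 : deriv Q 0 = 0)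
    (hQrr0 : deriv (deriv Q) 0 = μ) :
    Tendsto (deriv Q) (𝓝[>] 0) (𝓝 0) ∧ Tendsto (fun r => deriv Q r / r) (𝓝[>] 0) (𝓝 μ) ∧
      Tendsto (deriv (deriv Q)) (𝓝[>] 0) (𝓝 μ) := by
  have hdiff : HasDerivAt (deriv Q) μ 0 := by
    rw [← hQrr0]
    exact (differentiableAt_of_deriv_ne_zero (by rwa [hQrr0])).hasDerivAt
  have hlim : Tendsto (deriv Q) (𝓝[>] 0) (𝓝 0) := by
    have := hdiff.continuousAt.tendsto
    rw [hQr0] at this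
    exact this.mono_left nhdsWithin_le_nhds
  have hS : UniqueDiffOn ℝ (Ico 0 τ) := uniqueDiffOn_Ico 0 τ
  have hIoo : Ioo 0 τ ∈ 𝓝[>] (0:ℝ) := Ioo_mem_nhdsGT hτ
  have h0 : (0:ℝ) ∈ Ico 0 τ := ⟨le_rfl, hτ⟩
  have hle : 𝓝[>] (0:ℝ) ≤ 𝓝[Ico 0 τ] 0 :=
    nhdsWithin_le_of_mem (mem_of_superset hIoo Ioo_subset_Ico_self)
  have hD1 : ContDiffOn ℝ 2 (derivWithin Q (Ico 0 τ)) (Ico 0 τ) :=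
    hreg.derivWithin hS (by norm_num)
  have hD2 : ContDiffOn ℝ 1 (derivWithin (derivWithin Q (Ico 0 τ)) (Ico 0 τ)) (Ico 0 τ) :=
    hD1.derivWithin hS (by norm_num)
  have hmem : ∀ r ∈ Ioo 0 τ, Ico 0 τ ∈ 𝓝 r := fun r hr => Ico_mem_nhds hr.1 hr.2
  have heq1 : EqOn (derivWithin Q (Ico 0 τ)) (deriv Q) (Ico 0 τ) := by
    intro r hr
    rcases hr.1.eq_or_lt with rfl | hr0
    · rw [hQr0]
      refine tendsto_nhds_unique ((hD1.continuousOn 0 h0).mono_left hle) (hlim.congr' ?_)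
      filter_upwards [hIoo] with s hs
      exact (derivWithin_of_mem_nhds (hmem s hs)).symm
    · exact derivWithin_of_mem_nhds (hmem r ⟨hr0, hr.2⟩)
  have heq2 : EqOn (derivWithin (derivWithin Q (Ico 0 τ)) (Ico 0 τ)) (deriv (deriv Q))
      (Ico 0 τ) := by
    intro r hr
    rw [derivWithin_congr heq1 (heq1 hr)]
    rcases hr.1.eq_or_lt with rfl | hr0
    · rw [hQrr0]
      exact hdiff.hasDerivWithinAt.derivWithin (hS 0 h0)
    · exact derivWithin_of_mem_nhds (hmem r ⟨hr0, hr.2⟩)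
  refine ⟨hlim, ?_, ?_⟩
  · have := (hasDerivAt_iff_tendsto_slope.mp hdiff).mono_left
      (nhdsWithin_mono 0 fun x (hx : 0 < x) => hx.ne')
    refine this.congr fun r => ?_
    simp [slope_def_field, hQr0]
  · have := (hD2.continuousOn 0 h0).mono_left hle
    rw [heq2 h0, hQrr0] at this
    refine this.congr' ?_
    filter_upwards [hIoo] with s hs
    exact heq2 (Ioo_subset_Ico_self hs)

lemma magmaODE.third_deriv_eq {d n c r : ℝ} {Q : ℝ → ℝ} (h : magmaODE d n c Q r) (hr : 0 < r)
    (hQ : 0 < Q r) (h1 : DifferentiableAt ℝ Q r) (h2 : DifferentiableAt ℝ (deriv Q) r)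
    (h3 : DifferentiableAt ℝ (deriv (deriv Q)) r) :
    deriv (deriv (deriv Q)) r + n * deriv Q r * deriv (deriv Q) r / Q r
        + (d - 1) * ((deriv (deriv Q) r * r - deriv Q r) / r ^ 2)
      = deriv Q r * (Q r ^ (-n) - n / c * (Q r)⁻¹) := by
  have hp := h1.hasDerivAt.rpow_const (p := n) (Or.inl hQ.ne')
  have hm := hp.mul h3.hasDerivAt
  have hs := h2.hasDerivAt.div (hasDerivAt_id' r) hr.ne'
  have e2 : deriv (fun s => Q s ^ n * deriv (deriv Q) s) r = _ := hm.deriv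
  have e3 : deriv (fun s => deriv Q s / s) r = _ := hs.deriv
  rw [magmaODE, hp.deriv, e2, e3, Real.rpow_sub_one hQ.ne'] at h
  have hP : 0 < Q r ^ n := Real.rpow_pos_of_pos hQ n
  rw [Real.rpow_neg hQ.le]
  generalize Q r ^ n = P at h hP
  refine mul_left_cancel₀ hP.ne' ?_
  have hPP : P * P⁻¹ = 1 := mul_inv_cancel₀ hP.ne'
  linear_combination h - deriv Q r * hPP

/-- The bound `Q_r^2 < 2 F₂(Q, μ) Q^{-n}` (inequality (bound) in the paper). -/
theorem magma_Qr_squared_bound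
    (d n c μ τ : ℝ) (hd : 1 ≤ d) (hn : n ∈ Icc (2:ℝ) 3) (hc : c ∈ Ico (1.55:ℝ) n)
    (hμ : μ < 0) (hτ : 0 < τ) (Q : ℝ → ℝ)
    (hreg : ContDiffOn ℝ 3 Q (Ico 0 τ))
    (hode : ∀ r ∈ Ioo (0:ℝ) τ, magmaODE d n c Q r)
    (hQ0 : Q 0 = 1) (hQr0 : deriv Q 0 = 0) (hQrr0 : deriv (deriv Q) 0 = μ)
    (hpos : ∀ r ∈ Ioo (0:ℝ) τ, 0 < Q r) (hdec : ∀ r ∈ Ioo (0:ℝ) τ, deriv Q r < 0) :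
    ∀ r ∈ Ioo (0:ℝ) τ,
      (deriv Q r) ^ 2 < 2 * F2 d n c (Q r) μ * (Q r) ^ (-n) := by
  have hn1 : n ≠ 1 := by linarith [hn.1]
  have hn0 : 0 < n := by linarith [hn.1]
  obtain ⟨hl1, hls, hl2⟩ := tendsto_derivs_nhdsGT_zero hτ hμ.ne hreg hQr0 hQrr0
  have hl0 : Tendsto Q (𝓝[>] 0) (𝓝 1) := by
    have := hreg.continuousOn 0 ⟨le_rfl, hτ⟩
    rw [ContinuousWithinAt, hQ0] at this
    exact this.mono_left
      (nhdsWithin_le_of_mem (mem_of_superset (Ioo_mem_nhdsGT hτ) Ioo_subset_Ico_self))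
  have hc1 : ContDiffOn ℝ 3 Q (Ioo 0 τ) := hreg.mono Ioo_subset_Ico_self
  have hc2 : ContDiffOn ℝ 2 (deriv Q) (Ioo 0 τ) := hc1.deriv_of_isOpen isOpen_Ioo (by norm_num)
  have hc3 : ContDiffOn ℝ 1 (deriv (deriv Q)) (Ioo 0 τ) :=
    hc2.deriv_of_isOpen isOpen_Ioo (by norm_num)
  have hasDeriv {k : WithTop ℕ∞} {f : ℝ → ℝ} (hf : ContDiffOn ℝ k f (Ioo 0 τ)) (hk : k ≠ 0) :
      ∀ r ∈ Ioo 0 τ, HasDerivAt f (deriv f r) r := fun r hr =>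
    ((hf.differentiableOn hk).differentiableAt (isOpen_Ioo.mem_nhds hr)).hasDerivAt
  have hd1 := hasDeriv hc1 (by norm_num)
  have hd2 := hasDeriv hc2 (by norm_num)
  have hd3 := hasDeriv hc3 (by norm_num)
  -- The once-integrated equation, with the sign-definite remainder on the other side.
  have hG : ∀ r ∈ Ioo 0 τ, 0 < deriv (deriv Q) r + (d - 1) * (deriv Q r / r)
      + n / 2 * (deriv Q r ^ 2 / Q r) - F1 d n c (Q r) μ := by
    refine pos_of_deriv_pos_of_tendsto_zero
      (f := fun r => deriv (deriv Q) r + (d - 1) * (deriv Q r / r)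
        + n / 2 * (deriv Q r ^ 2 / Q r) - F1 d n c (Q r) μ)
      (f' := fun r => -(n / 2) * (deriv Q r ^ 3 / Q r ^ 2)) (fun r hr => ?_) (fun r hr => ?_) ?_
    · have hQ := hpos r hr
      have hode' := (hode r hr).third_deriv_eq hr.1 hQ (hd1 r hr).differentiableAt
        (hd2 r hr).differentiableAt (hd3 r hr).differentiableAt
      have h := (((hd3 r hr).add
        (((hd2 r hr).div (hasDerivAt_id' r) hr.1.ne').const_mul (d - 1))).add
        ((((hd2 r hr).pow 2).div (hd1 r hr) hQ.ne').const_mul (n / 2))).sub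
        ((hasDerivAt_F1 (d := d) (c := c) (μ := μ) hn1 hQ).comp r (hd1 r hr))
      refine h.congr_deriv ?_
      have e : n / 2 * ((2 * deriv Q r * deriv (deriv Q) r * Q r - deriv Q r ^ 2 * deriv Q r)
          / Q r ^ 2) = n * deriv Q r * deriv (deriv Q) r / Q r
            - n / 2 * (deriv Q r ^ 3 / Q r ^ 2) := by
        field_simp
      simp only [Pi.pow_apply, Nat.cast_ofNat, Nat.add_one_sub_one, pow_one]
      linear_combination hode' + e
    · have h3 : deriv Q r ^ 3 < 0 := Odd.pow_neg (by decide) (hdec r hr)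
      have := div_neg_of_neg_of_pos h3 (pow_pos (hpos r hr) 2)
      nlinarith
    · have h := ((hl2.add (hls.const_mul (d - 1))).add
        (((hl1.pow 2).div hl0 one_ne_zero).const_mul (n / 2))).sub
        ((hasDerivAt_F1 (d := d) (c := c) (μ := μ) hn1 one_pos).continuousAt.tendsto.comp hl0)
      have e : μ + (d - 1) * μ + n / 2 * (0 ^ 2 / 1) - F1 d n c 1 μ = 0 := by
        simp [F1]
        ring
      rwa [e] at h
  have hH : ∀ r ∈ Ioo 0 τ, 0 < F2 d n c (Q r) μ - Q r ^ n * deriv Q r ^ 2 / 2 := by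
    refine pos_of_deriv_pos_of_tendsto_zero
      (f := fun r => F2 d n c (Q r) μ - Q r ^ n * deriv Q r ^ 2 / 2)
      (f' := fun r => Q r ^ n * (-deriv Q r) * (deriv (deriv Q) r
        + n / 2 * (deriv Q r ^ 2 / Q r) - F1 d n c (Q r) μ)) (fun r hr => ?_) (fun r hr => ?_) ?_
    · have hQ := hpos r hr
      have h := ((hasDerivAt_F2 (d := d) (c := c) (μ := μ) hn1 hQ).comp r (hd1 r hr)).sub
        ((((hd1 r hr).rpow_const (p := n) (Or.inl hQ.ne')).mul ((hd2 r hr).pow 2)).div_const 2)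
      refine h.congr_deriv ?_
      rw [Real.rpow_sub_one hQ.ne']
      simp only [Pi.pow_apply, Nat.cast_ofNat, Nat.add_one_sub_one, pow_one]
      ring
    · have hQ' := hdec r hr
      refine mul_pos (mul_pos (Real.rpow_pos_of_pos (hpos r hr) n) (neg_pos.mpr hQ')) ?_
      have : (d - 1) * (deriv Q r / r) ≤ 0 :=
        mul_nonpos_of_nonneg_of_nonpos (by linarith) (div_neg_of_neg_of_pos hQ' hr.1).le
      linarith [hG r hr]
    · have h := ((hasDerivAt_F2 (d := d) (c := c) (μ := μ) hn1
        one_pos).continuousAt.tendsto.comp hl0).sub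
        (((hl0.rpow_const (p := n) (Or.inl one_ne_zero)).mul (hl1.pow 2)).div_const 2)
      have e : F2 d n c 1 μ - 1 ^ n * 0 ^ 2 / 2 = 0 := by simp [F2]
      rwa [e] at h
  intro r hr
  have hP : 0 < Q r ^ n := Real.rpow_pos_of_pos (hpos r hr) n
  rw [Real.rpow_neg (hpos r hr).le, ← div_eq_mul_inv, lt_div_iff₀ hP]
  linarith [hH r hr]
end
end

section
/- Let d > 0 and n ∈ [2,3], and let h₃(Q) := d(1 − (n ln Q)/(n+1) − (n/(n+1)²)(Q^{−(n+1)} − 1)) for Q > 0. Then h₃ has a unique zero Q_* in the interval (0,1); Q_* depends only on n (not on d); and h₃(Q) > 0 for all Q ∈ (Q_*, 1]. -/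
open Set Filter Topology intervalIntegral Real

noncomputable section

lemma strictMonoOn_exp_sub_id : StrictMonoOn (fun t : ℝ => Real.exp t - t) (Ici 0) := by
  intro a ha b _ hab
  have h₁ : b - a + 1 < Real.exp (b - a) := Real.add_one_lt_exp (sub_ne_zero.mpr hab.ne')
  have h₂ : 1 ≤ Real.exp a := Real.one_le_exp ha
  have h₃ : Real.exp b = Real.exp a * Real.exp (b - a) := by
    rw [← Real.exp_add]; ring_nf
  show Real.exp a - a < Real.exp b - b
  rw [h₃]
  nlinarith

/-- In the variable `t = -(n + 1) * log Q`, the function `h3ex` is affine in `exp t - t`. -/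
lemma h3ex_eq_exp_sub (d n Q : ℝ) (hn : 0 < n) (hQ : 0 < Q) :
    h3ex d n Q = d * (n / (n + 1) ^ 2) * (1 + (n + 1) ^ 2 / n -
      (Real.exp (-(n + 1) * Real.log Q) - (-(n + 1) * Real.log Q))) := by
  have h : n + 1 ≠ 0 := by positivity
  rw [h3ex, Real.rpow_def_of_pos hQ, mul_comm (Real.log Q)]
  field_simp
  ring

/-- h₃ has a unique zero Q_* in (0,1), depending only on n, and h₃ > 0 on (Q_*, 1]. -/
theorem magma_h3_unique_zero
    (d n : ℝ) (hd : 0 < d) (hn : n ∈ Icc (2:ℝ) 3) :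
    ∃ Qs ∈ Ioo (0:ℝ) 1, h3ex d n Qs = 0 ∧
      (∀ Q ∈ Ioo (0:ℝ) 1, h3ex d n Q = 0 → Q = Qs) ∧
      (∀ d' : ℝ, 0 < d' → h3ex d' n Qs = 0) ∧
      (∀ Q ∈ Ioc Qs (1:ℝ), 0 < h3ex d n Q) := by
  obtain ⟨hn₂, hn₃⟩ := hn
  have hn₀ : 0 < n := by linarith
  have hn₁ : 0 < n + 1 := by linarith
  have hk : 0 < n / (n + 1) ^ 2 := by positivity
  have hpos : 0 < (n + 1) ^ 2 / n := by positivity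
  have hle : (n + 1) ^ 2 / n ≤ 8 := by
    rw [div_le_iff₀ hn₀]; nlinarith
  obtain ⟨t, ht, hgt⟩ : ∃ t ∈ Icc (0 : ℝ) 10, Real.exp t - t = 1 + (n + 1) ^ 2 / n := by
    refine intermediate_value_Icc (f := fun t : ℝ => Real.exp t - t) (by norm_num)
      (by fun_prop) ⟨?_, ?_⟩
    · simpa using hpos.le
    · have := Real.quadratic_le_exp_of_nonneg (x := 10) (by norm_num)
      linarith
  have ht₀ : 0 < t := by
    refine ht.1.lt_of_ne ?_
    rintro rfl
    norm_num at hgt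
    rcases hgt with h | h <;> linarith
  have hlog : -(n + 1) * Real.log (Real.exp (-t / (n + 1))) = t := by
    rw [Real.log_exp]; field_simp
  have hzero (d' : ℝ) : h3ex d' n (Real.exp (-t / (n + 1))) = 0 := by
    rw [h3ex_eq_exp_sub _ _ _ hn₀ (Real.exp_pos _), hlog, hgt]; ring
  have hlt : Real.exp (-t / (n + 1)) < 1 :=
    Real.exp_lt_one_iff.mpr (div_neg_of_neg_of_pos (neg_neg_of_pos ht₀) hn₁)
  refine ⟨Real.exp (-t / (n + 1)), ⟨Real.exp_pos _, hlt⟩, hzero d, ?_, fun d' _ => hzero d', ?_⟩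
  · intro Q hQ h
    rw [h3ex_eq_exp_sub _ _ _ hn₀ hQ.1, mul_eq_zero, or_iff_right (by positivity), ← hgt,
      sub_eq_zero] at h
    have hnn : 0 ≤ -(n + 1) * Real.log Q := by
      nlinarith [Real.log_neg hQ.1 hQ.2]
    have hQt : t = -(n + 1) * Real.log Q := strictMonoOn_exp_sub_id.injOn ht.1 hnn h
    rw [hQt, ← Real.exp_log hQ.1, Real.log_exp]
    congr 1
    field_simp
  · intro Q hQ
    have hQ₀ : 0 < Q := (Real.exp_pos _).trans hQ.1
    have hnn : 0 ≤ -(n + 1) * Real.log Q := by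
      nlinarith [Real.log_nonpos hQ₀.le hQ.2]
    have hQt : -(n + 1) * Real.log Q < t := by
      have := Real.log_lt_log (Real.exp_pos _) hQ.1
      nlinarith
    have := strictMonoOn_exp_sub_id hnn ht.1 hQt
    rw [h3ex_eq_exp_sub _ _ _ hn₀ hQ₀, ← hgt]
    exact mul_pos (by positivity) (sub_pos.mpr this)
end
end
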